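/- arXiv:2601.15208 — 4 statements merged into one kernel-verified Lean document; each statement's English description precedes it below -/
import Mathlib

section
/- Under Assumption A, if α > 3, then for every minimizer z ∈ argmin φ the limit lim_{t→∞} ‖x(t) − z‖ exists (i.e., the real-valued function t ↦ ‖x(t) − z‖ converges as t → ∞). -/
open scoped BigOperators
open Set Filter MeasureTheory

/-- The supremum function `φ(x) = max_{λ ∈ Q} ∑ i, λ_i g_i(x)`. -/
noncomputable def phi {H : Type*} (m : ℕ) (g : Fin m → H → ℝ)
    (Q : Set (EuclideanSpace ℝ (Fin m))) (x : H) : ℝ :=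
  sSup ((fun l : EuclideanSpace ℝ (Fin m) => ∑ i, l i * g i x) '' Q)

/-- The regularized function `φ_μ(x) = max_{λ ∈ Q} ( ∑ i, λ_i g_i(x) - μ D(λ) )`. -/
noncomputable def phiMu {H : Type*} (m : ℕ) (g : Fin m → H → ℝ)
    (Q : Set (EuclideanSpace ℝ (Fin m))) (D : EuclideanSpace ℝ (Fin m) → ℝ)
    (μ : ℝ) (x : H) : ℝ :=
  sSup ((fun l : EuclideanSpace ℝ (Fin m) => ∑ i, l i * g i x - μ * D l) '' Q)


lemma aux_antitone {F : ℝ → ℝ} {T : ℝ} (hF : ContinuousOn F (Ici T))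
    (h : ∀ s ∈ Ici T, ∃ (q : ℝ → ℝ) (d : ℝ), (∀ t, s ≤ t → F t ≤ q t) ∧ q s = F s ∧
      HasDerivAt q d s ∧ d ≤ 0) : AntitoneOn F (Ici T) := by
  intro a ha b hb hab
  have := image_le_of_liminf_slope_right_le_deriv_boundary (f := F) (a := a) (b := b)
    (hF.mono (fun y hy => le_trans ha hy.1)) (B := fun _ => F a) (B' := fun _ => 0) le_rfl
    continuousOn_const (fun y _ => hasDerivWithinAt_const _ _ _) ?_ (x := b) ⟨hab, le_rfl⟩
  · exact this
  · intro s hs r hr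
    obtain ⟨q, d, h1, h2, h3, h4⟩ := h s (le_trans ha hs.1)
    have h5 : Tendsto (slope q s) (nhdsWithin s (Ioi s)) (nhds d) :=
      (hasDerivAt_iff_tendsto_slope.1 h3).mono_left
        (nhdsWithin_mono _ (fun y hy => ne_of_gt hy))
    have h6 : ∀ᶠ z in nhdsWithin s (Ioi s), slope q s z < r :=
      h5.eventually (gt_mem_nhds (lt_of_le_of_lt h4 hr))
    have h7 : ∀ᶠ z in nhdsWithin s (Ioi s), slope F s z < r := by
      filter_upwards [h6, self_mem_nhdsWithin] with z hz hz'
      refine lt_of_le_of_lt ?_ hz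
      have hz'' : s < z := hz'
      rw [slope_def_field, slope_def_field, h2]
      have := h1 z hz''.le
      have : 0 < z - s := by linarith
      gcongr
    exact h7.frequently

lemma aux_conv {F : ℝ → ℝ} {T B : ℝ} (hF : AntitoneOn F (Ici T)) (hB : ∀ t ∈ Ici T, B ≤ F t) :
    ∃ L, Tendsto F atTop (nhds L) := by
  have h1 : Antitone (fun t => F (max t T)) := by
    intro a b hab
    exact hF (mem_Ici.2 (le_max_right _ _)) (mem_Ici.2 (le_max_right _ _)) (max_le_max hab le_rfl)
  have h2 := tendsto_atTop_ciInf h1 ⟨B, by rintro _ ⟨t, rfl⟩; exact hB _ (mem_Ici.2 (le_max_right _ _))⟩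
  refine ⟨_, h2.congr' ?_⟩
  filter_upwards [eventually_ge_atTop T] with t ht
  rw [max_eq_left ht]

lemma aux_upper {u u' : ℝ → ℝ} {T a e : ℝ} (ha : 0 < a) (hT : 0 < T)
    (hu : ∀ t ∈ Ici T, HasDerivAt u (u' t) t) (h : ∀ t ∈ Ici T, t * u' t + a * u t ≤ a * e) :
    ∀ e' > e, ∀ᶠ t in atTop, u t < e' := by
  have hd : ∀ t ∈ Ici T, HasDerivAt (fun t => t ^ a * (u t - e))
      ((1 * a * t ^ (a - 1)) * (u t - e) + t ^ a * u' t) t := by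
    intro t ht
    have ht0 : 0 < t := lt_of_lt_of_le hT ht
    exact ((hasDerivAt_id t).rpow_const (Or.inl ht0.ne')).mul ((hu t ht).sub_const e)
  have hanti : AntitoneOn (fun t => t ^ a * (u t - e)) (Ici T) := by
    apply aux_antitone
    · exact fun t ht => (hd t ht).continuousAt.continuousWithinAt
    · intro s hs
      refine ⟨_, _, fun t _ => le_rfl, rfl, hd s hs, ?_⟩
      have hs0 : 0 < s := lt_of_lt_of_le hT hs
      have h1 : s ^ a = s ^ (a - 1) * s := by
        rw [← Real.rpow_add_one hs0.ne']; ring_nf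
      have h2 : 0 < s ^ (a - 1) := Real.rpow_pos_of_pos hs0 _
      rw [h1]
      have h3 := h s hs
      nlinarith [mul_le_mul_of_nonneg_left h3 h2.le]
  intro e' he'
  set K := T ^ a * (u T - e) with hK
  have h1 : Tendsto (fun t : ℝ => t ^ a * (e' - e)) atTop atTop :=
    (tendsto_rpow_atTop ha).atTop_mul_const (by linarith)
  filter_upwards [h1.eventually_gt_atTop K, eventually_ge_atTop T] with t h2 h3
  have h4 : t ^ a * (u t - e) ≤ K := hanti self_mem_Ici h3 h3
  have h5 : 0 < t ^ a := Real.rpow_pos_of_pos (lt_of_lt_of_le hT h3) _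
  have := lt_of_mul_lt_mul_left (lt_of_le_of_lt h4 h2) h5.le
  linarith

lemma aux_lim {u u' : ℝ → ℝ} {T a l : ℝ} (ha : 0 < a)
    (hu : ∀ t ∈ Ici T, HasDerivAt u (u' t) t)
    (h : Tendsto (fun t => t * u' t + a * u t) atTop (nhds (a * l))) :
    Tendsto u atTop (nhds l) := by
  have key : ∀ (v v' : ℝ → ℝ) (k : ℝ), (∀ t ∈ Ici T, HasDerivAt v (v' t) t) →
      Tendsto (fun t => t * v' t + a * v t) atTop (nhds (a * k)) →
      ∀ e' > k, ∀ᶠ t in atTop, v t < e' := by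
    intro v v' k hv hk e' he'
    have h1 : a * k < a * ((k + e') / 2) := by
      apply mul_lt_mul_of_pos_left _ ha; linarith
    have h2 := (hk.eventually (gt_mem_nhds h1)).and
      ((eventually_ge_atTop T).and (eventually_gt_atTop 0))
    obtain ⟨S, hS⟩ := eventually_atTop.1 h2
    exact aux_upper (T := S) ha (hS S le_rfl).2.2
      (fun t ht => hv t (hS t ht).2.1) (fun t ht => (hS t ht).1.le) e' (by linarith)
  rw [tendsto_order]
  constructor
  · intro b hb
    have := key (fun t => - u t) (fun t => - u' t) (-l) (fun t ht => (hu t ht).neg)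
      (by have := h.neg
          refine Tendsto.congr' ?_ (this.trans (by simp))
          exact Eventually.of_forall (fun t => by ring)) (-b) (by linarith)
    filter_upwards [this] with t ht
    linarith
  · intro b hb
    exact key u u' l hu h b hb

section D
variable {H : Type*} {m : ℕ} {g : Fin m → H → ℝ}
  {Q : Set (EuclideanSpace ℝ (Fin m))} {D : EuclideanSpace ℝ (Fin m) → ℝ}

lemma aux_cont (hDcont : Continuous D) (ν : ℝ) (y : H) :
    Continuous (fun l : EuclideanSpace ℝ (Fin m) => ∑ i, l i * g i y - ν * D l) := by
  fun_prop

lemma aux_le (hQcomp : IsCompact Q) (hDcont : Continuous D) (ν : ℝ) (y : H)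
    {l : EuclideanSpace ℝ (Fin m)} (hl : l ∈ Q) :
    ∑ i, l i * g i y - ν * D l ≤ phiMu m g Q D ν y :=
  le_csSup (hQcomp.bddAbove_image (aux_cont hDcont ν y).continuousOn) ⟨l, hl, rfl⟩

lemma aux_max (hQne : Q.Nonempty) (hQcomp : IsCompact Q) (hDcont : Continuous D) (ν : ℝ) (y : H) :
    ∃ l ∈ Q, phiMu m g Q D ν y = ∑ i, l i * g i y - ν * D l := by
  obtain ⟨l, hl, h1⟩ := hQcomp.exists_sSup_image_eq hQne (aux_cont (g := g) hDcont ν y).continuousOn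
  exact ⟨l, hl, h1⟩

lemma aux_phi (D : EuclideanSpace ℝ (Fin m) → ℝ) (y : H) : phi m g Q y = phiMu m g Q D 0 y := by
  simp [phi, phiMu]

lemma aux_mono (hQne : Q.Nonempty) (hQcomp : IsCompact Q) (hDcont : Continuous D)
    (hD0 : ∀ l ∈ Q, 0 ≤ D l) {ν ρ : ℝ} (h : ν ≤ ρ) (y : H) :
    phiMu m g Q D ρ y ≤ phiMu m g Q D ν y := by
  obtain ⟨l, hl, h1⟩ := aux_max (g := g) hQne hQcomp hDcont ρ y
  have := aux_le (g := g) hQcomp hDcont ν y hl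
  nlinarith [mul_le_mul_of_nonneg_right h (hD0 l hl)]

lemma aux_mono2 (hQne : Q.Nonempty) (hQcomp : IsCompact Q) (hDcont : Continuous D) {C : ℝ}
    (hDC : ∀ l ∈ Q, D l ≤ C) {ν ρ : ℝ} (h : ν ≤ ρ) (y : H) :
    phiMu m g Q D ν y + C * ν ≤ phiMu m g Q D ρ y + C * ρ := by
  obtain ⟨l, hl, h1⟩ := aux_max (g := g) hQne hQcomp hDcont ν y
  have := aux_le (g := g) hQcomp hDcont ρ y hl
  nlinarith [mul_le_mul_of_nonneg_left (hDC l hl) (sub_nonneg.2 h)]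

variable [NormedAddCommGroup H] [InnerProductSpace ℝ H]

lemma aux_convex (hQne : Q.Nonempty) (hQcomp : IsCompact Q) (hDcont : Continuous D)
    (hg : ∀ i, ConvexOn ℝ Set.univ (g i)) (hQpos : ∀ l ∈ Q, ∀ i, 0 ≤ l i) (ν : ℝ) :
    ConvexOn ℝ Set.univ (phiMu m g Q D ν) := by
  refine ⟨convex_univ, ?_⟩
  intro y _ z _ a b ha hb hab
  obtain ⟨l, hl, h1⟩ := aux_max (g := g) hQne hQcomp hDcont ν (a • y + b • z)
  have h2 := mul_le_mul_of_nonneg_left (aux_le (g := g) hQcomp hDcont ν y hl) ha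
  have h3 := mul_le_mul_of_nonneg_left (aux_le (g := g) hQcomp hDcont ν z hl) hb
  have h4 : ∑ i, l i * g i (a • y + b • z) ≤ a * ∑ i, l i * g i y + b * ∑ i, l i * g i z := by
    rw [Finset.mul_sum, Finset.mul_sum, ← Finset.sum_add_distrib]
    apply Finset.sum_le_sum
    intro i _
    have := mul_le_mul_of_nonneg_left ((hg i).2 (mem_univ y) (mem_univ z) ha hb hab) (hQpos l hl i)
    simp only [smul_eq_mul] at this
    linarith
  have h5 : ν * D l = a * (ν * D l) + b * (ν * D l) := by rw [← add_mul, hab, one_mul]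
  simp only [smul_eq_mul]
  rw [h1]
  linarith

lemma aux_diff (hQne : Q.Nonempty) (hQcomp : IsCompact Q) (hDcont : Continuous D)
    (hQconv : Convex ℝ Q) (hgdiff : ∀ i, Differentiable ℝ (g i))
    {σ : ℝ} (hσ : 0 < σ) (hDsc : StrongConvexOn Q σ D) {ν : ℝ} (hν : 0 < ν) (y : H) :
    DifferentiableAt ℝ (phiMu m g Q D ν) y := by
  obtain ⟨l, hl, h1⟩ := aux_max (g := g) hQne hQcomp hDcont ν y
  have hνσ : 0 < ν * σ := mul_pos hν hσ
  -- quadratic growth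
  have h2 : ∀ k ∈ Q, ∑ i, k i * g i y - ν * D k ≤ phiMu m g Q D ν y
      - ν * σ / 4 * ∑ i, (k i - l i) ^ 2 := by
    intro k hk
    have hmid : (1/2 : ℝ) • k + (1/2 : ℝ) • l ∈ Q :=
      hQconv hk hl (by norm_num) (by norm_num) (by norm_num)
    have h3 := aux_le (g := g) hQcomp hDcont ν y hmid
    have h4 := hDsc.2 hk hl (show (0:ℝ) ≤ 1/2 by norm_num) (show (0:ℝ) ≤ 1/2 by norm_num) (by norm_num)
    have h5 : ‖k - l‖ ^ 2 = ∑ i, (k i - l i) ^ 2 := by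
      rw [EuclideanSpace.norm_sq_eq]
      simp
    have h6 : ∑ i, ((1/2 : ℝ) • k + (1/2 : ℝ) • l) i * g i y
        = 1/2 * ∑ i, k i * g i y + 1/2 * ∑ i, l i * g i y := by
      rw [Finset.mul_sum, Finset.mul_sum, ← Finset.sum_add_distrib]
      apply Finset.sum_congr rfl
      intro i _
      simp
      ring
    simp only [smul_eq_mul] at h4
    rw [h5] at h4
    rw [h6] at h3
    have h7 := mul_le_mul_of_nonneg_left h4 hν.le
    nlinarith
  set r : H → ℝ := fun w => phiMu m g Q D ν w - ∑ i, l i * g i w with hr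
  set k : H → ℝ := fun w => 1 / (ν * σ) * ∑ i, (g i w - g i y) ^ 2 with hk
  have hlow : ∀ w, 0 ≤ r w - r y := by
    intro w
    have := aux_le (g := g) hQcomp hDcont ν w hl
    simp only [hr]; linarith
  have hup : ∀ w, r w - r y ≤ k w := by
    intro w
    obtain ⟨p, hp, h3⟩ := aux_max (g := g) hQne hQcomp hDcont ν w
    have h4 := h2 p hp
    have h5 : ∑ i, (p i - l i) * (g i w - g i y) ≤
        ν * σ / 4 * ∑ i, (p i - l i) ^ 2 + 1 / (ν * σ) * ∑ i, (g i w - g i y) ^ 2 := by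
      rw [Finset.mul_sum, Finset.mul_sum, ← Finset.sum_add_distrib]
      apply Finset.sum_le_sum
      intro i _
      generalize p i - l i = A
      generalize g i w - g i y = B
      have : ν * σ / 4 * A ^ 2 + 1 / (ν * σ) * B ^ 2 - A * B
        = (ν * σ * A / 2 - B) ^ 2 / (ν * σ) := by field_simp; ring
      have h9 : 0 ≤ (ν * σ * A / 2 - B) ^ 2 / (ν * σ) := by positivity
      linarith
    have h6 : ∑ i, (p i - l i) * (g i w - g i y) = ∑ i, p i * g i w - ∑ i, p i * g i y
        - ∑ i, l i * g i w + ∑ i, l i * g i y := by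
      rw [← Finset.sum_sub_distrib, ← Finset.sum_sub_distrib, ← Finset.sum_add_distrib]
      apply Finset.sum_congr rfl
      intro i _; ring
    simp only [hr, hk]
    linarith
  have hkd : HasFDerivAt k (0 : H →L[ℝ] ℝ) y := by
    have hkdiff : DifferentiableAt ℝ k y := by
      have := fun i => (hgdiff i) y
      simp only [hk]
      fun_prop
    have hmin : IsLocalMin k y := by
      refine Eventually.of_forall (fun w => ?_)
      simp only [hk, sub_self]
      have : 0 ≤ 1 / (ν * σ) * ∑ i, (g i w - g i y) ^ 2 := by positivity
      simpa using this
    have := hkdiff.hasFDerivAt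
    rwa [hmin.fderiv_eq_zero] at this
  have hrd : HasFDerivAt r (0 : H →L[ℝ] ℝ) y := by
    rw [hasFDerivAt_iff_isLittleO] at hkd ⊢
    refine Asymptotics.IsBigO.trans_isLittleO ?_ hkd
    apply Asymptotics.IsBigO.of_bound 1
    refine Eventually.of_forall (fun w => ?_)
    have hky : k y = 0 := by simp [hk]
    simp only [_root_.zero_apply, sub_zero, hky, one_mul]
    rw [Real.norm_of_nonneg (hlow w), Real.norm_of_nonneg ((hlow w).trans (hup w))]
    exact hup w
  have hsum : DifferentiableAt ℝ (fun w => ∑ i, l i * g i w) y := by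
    have := fun i => (hgdiff i) y
    fun_prop
  have := hrd.differentiableAt.add hsum
  refine this.congr_of_eventuallyEq (Eventually.of_forall (fun w => ?_))
  simp [hr]

end D

lemma aux_grad {H : Type*} [NormedAddCommGroup H] [InnerProductSpace ℝ H] [CompleteSpace H]
    {f : H → ℝ} (hf : ConvexOn ℝ univ f) {y : H} (hd : DifferentiableAt ℝ f y) (z : H) :
    f y + inner ℝ (gradient f y) (z - y) ≤ f z := by
  have h1 : HasDerivAt (fun s : ℝ => f (y + s • (z - y))) (inner ℝ (gradient f y) (z - y)) 0 := by
    have h2 : HasDerivAt (fun s : ℝ => y + s • (z - y)) (z - y) 0 := by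
      simpa using ((hasDerivAt_id (0 : ℝ)).smul_const (z - y)).const_add y
    have h3 : HasFDerivAt f (InnerProductSpace.toDual ℝ H (gradient f y)) (y + (0 : ℝ) • (z - y)) := by
      simpa using hd.hasGradientAt.hasFDerivAt
    exact h3.comp_hasDerivAt (0 : ℝ) h2
  have h4 : ConvexOn ℝ univ (fun s : ℝ => f (y + s • (z - y))) := by
    refine ⟨convex_univ, ?_⟩
    intro s _ t _ a b ha hb hab
    have h5 := hf.2 (mem_univ (y + s • (z - y))) (mem_univ (y + t • (z - y))) ha hb hab
    convert h5 using 2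
    have : y = (a + b) • y := by rw [hab, one_smul]
    simp only [smul_eq_mul]
    nth_rewrite 1 [this]
    module
  have h6 := h4.le_slope_of_hasDerivAt (mem_univ 0) (mem_univ 1) zero_lt_one h1
  rw [slope_def_field] at h6
  simp only [one_smul, zero_smul, add_zero, sub_zero, div_one, add_sub_cancel] at h6
  linarith

lemma aux_dyn {H : Type*} [NormedAddCommGroup H] [InnerProductSpace ℝ H] [CompleteSpace H]
    {P : ℝ → H → ℝ} {T α C φs : ℝ} {μ M : ℝ → ℝ} {x x' x'' : ℝ → H} {z : H}
    (hT : 0 < T)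
    (hμ : ContinuousOn μ (Ici T))
    (hx' : ∀ t ∈ Ici T, HasDerivAt x (x' t) t)
    (hx'' : ∀ t ∈ Ici T, HasDerivAt x' (x'' t) t)
    (hODE : ∀ t ∈ Ici T, x'' t + (α / t) • x' t + gradient (P t) (x t) = 0)
    (hM : ∀ t ∈ Ici T, HasDerivAt M (t * μ t) t)
    (p1 : ∀ t ∈ Ici T, ∀ y, DifferentiableAt ℝ (P t) y)
    (p2 : ∀ t ∈ Ici T, ∀ y, P t y + inner ℝ (gradient (P t) y) (z - y) ≤ P t z)
    (p3 : ∀ t ∈ Ici T, P t z ≤ φs)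
    (p4 : ∀ t ∈ Ici T, ∀ y, φs ≤ P t y + C * μ t)
    (p5 : ∀ s ∈ Ici T, ∀ t ∈ Ici T, s ≤ t → ∀ y, P t y + C * μ t ≤ P s y + C * μ s)
    (p6 : ∀ s ∈ Ici T, ∀ t ∈ Ici T, ∀ y, |P t y - P s y| ≤ C * |μ t - μ s|)
    {b : ℝ} (hb2 : 2 ≤ b) (hbα : b ≤ α - 1) :
    AntitoneOn (fun t => t ^ 2 * (P t (x t) + C * μ t - φs) + 1 / 2 * t ^ 2 * ‖x' t‖ ^ 2
      + b * (t * inner ℝ (x t - z) (x' t) + (α - 1) / 2 * ‖x t - z‖ ^ 2) - b * C * M t) (Ici T) := by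
  set R : ℝ → ℝ := fun t => 1 / 2 * t ^ 2 * ‖x' t‖ ^ 2
      + b * (t * inner ℝ (x t - z) (x' t) + (α - 1) / 2 * ‖x t - z‖ ^ 2) - b * C * M t with hR
  have hRd : ∀ t ∈ Ici T, HasDerivAt R (t * ‖x' t‖ ^ 2 + t ^ 2 * inner ℝ (x' t) (x'' t)
      + b * (inner ℝ (x t - z) (x' t) + t * (inner ℝ (x t - z) (x'' t) + ‖x' t‖ ^ 2)
        + (α - 1) * inner ℝ (x t - z) (x' t)) - b * C * (t * μ t)) t := by
    intro t ht
    have e1 := ((hasDerivAt_pow 2 t).const_mul (1 / 2)).mul (hx'' t ht).norm_sq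
    have e2 := (hasDerivAt_id t).mul (((hx' t ht).sub_const z).inner ℝ (hx'' t ht))
    have e3 := (((hx' t ht).sub_const z).norm_sq).const_mul ((α - 1) / 2)
    have e4 := (e1.add ((e2.add e3).const_mul b)).sub ((hM t ht).const_mul (b * C))
    refine e4.congr_deriv ?_
    rw [real_inner_self_eq_norm_sq]
    simp
    ring
  have hPc : ContinuousOn (fun t => P t (x t)) (Ici T) := by
    intro s hs
    have c1 : Tendsto (fun t => P s (x t)) (nhdsWithin s (Ici T)) (nhds (P s (x s))) :=
      (((p1 s hs (x s)).continuousAt).comp (hx' s hs).continuousAt).continuousWithinAt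
    have c2 : Tendsto (fun t => C * |μ t - μ s|) (nhdsWithin s (Ici T)) (nhds 0) := by
      have : Tendsto (fun t => C * |μ t - μ s|) (nhdsWithin s (Ici T)) (nhds (C * |μ s - μ s|)) :=
        (((hμ s hs).sub_const (μ s)).abs).const_mul C
      simpa using this
    have c3 : Tendsto (fun t => P t (x t) - P s (x t)) (nhdsWithin s (Ici T)) (nhds 0) := by
      apply squeeze_zero_norm' _ c2
      filter_upwards [self_mem_nhdsWithin] with t ht
      exact p6 s hs t ht _
    have := c3.add c1
    simpa [ContinuousWithinAt] using this
  have hFR : (fun t => t ^ 2 * (P t (x t) + C * μ t - φs) + 1 / 2 * t ^ 2 * ‖x' t‖ ^ 2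
      + b * (t * inner ℝ (x t - z) (x' t) + (α - 1) / 2 * ‖x t - z‖ ^ 2) - b * C * M t)
      = fun t => t ^ 2 * (P t (x t) + C * μ t - φs) + R t := by
    funext t; simp only [hR]; ring
  rw [hFR]
  apply aux_antitone
  · have : ContinuousOn R (Ici T) := fun t ht => (hRd t ht).continuousAt.continuousWithinAt
    exact ((continuousOn_id.pow 2).mul ((hPc.add (continuousOn_const.mul hμ)).sub continuousOn_const)).add this
  · intro s hs
    have hs0 : 0 < s := lt_of_lt_of_le hT hs
    have d1 : HasDerivAt (fun t => P s (x t)) (inner ℝ (gradient (P s) (x s)) (x' s)) s := by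
      have := (p1 s hs (x s)).hasGradientAt.hasFDerivAt
      exact this.comp_hasDerivAt s (hx' s hs)
    have d2 := ((hasDerivAt_pow 2 s).mul ((d1.add_const (C * μ s)).sub_const φs)).add (hRd s hs)
    refine ⟨_, _, ?_, ?_, d2, ?_⟩
    · intro t hst
      have := p5 s hs t (le_trans hs hst) hst (x t)
      have h2 : t ^ 2 * (P t (x t) + C * μ t - φs) ≤ t ^ 2 * (P s (x t) + C * μ s - φs) := by
        gcongr
      simp only [Pi.add_apply, Pi.mul_apply]
      linarith
    · simp
    · have hgr : gradient (P s) (x s) = - x'' s - (α / s) • x' s := by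
        have := hODE s hs
        rw [add_eq_zero_iff_eq_neg] at this
        rw [← neg_neg (gradient (P s) (x s)), ← this]; abel
      have h2 := p2 s hs (x s)
      have h3 := p3 s hs
      have h4 := p4 s hs (x s)
      have i1 : inner ℝ (gradient (P s) (x s)) (x' s)
          = - inner ℝ (x' s) (x'' s) - α / s * ‖x' s‖ ^ 2 := by
        rw [hgr, inner_sub_left, inner_neg_left, real_inner_smul_left, real_inner_self_eq_norm_sq,
          real_inner_comm]
      have i2 : inner ℝ (gradient (P s) (x s)) (z - x s)
          = inner ℝ (x s - z) (x'' s) + α / s * inner ℝ (x s - z) (x' s) := by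
        rw [hgr, ← neg_sub (x s) z, inner_neg_right, inner_sub_left, inner_neg_left,
          real_inner_smul_left, real_inner_comm, real_inner_comm (x s - z) (x' s)]
        ring
      rw [i2] at h2
      rw [i1]
      generalize inner ℝ (x s - z) (x'' s) = Y at *
      generalize inner ℝ (x s - z) (x' s) = Z at *
      generalize inner ℝ (x' s) (x'' s) = X at *
      have hN : 0 ≤ ‖x' s‖ ^ 2 := by positivity
      generalize ‖x' s‖ ^ 2 = N at *
      generalize P s (x s) = p at *
      generalize P s z = p' at *
      have h5 : s * (p - φs) + s * Y + α * Z ≤ 0 := by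
        have : s * (p - φs) + s * Y + α * Z = s * (p + (Y + α / s * Z) - φs) := by
          field_simp; ring
        rw [this]
        apply mul_nonpos_of_nonneg_of_nonpos hs0.le; linarith
      have h6 : s ^ 2 * (-X - α / s * N) = - s ^ 2 * X - α * s * N := by field_simp
      have h7 : 0 ≤ (b - 2) * (s * (p + C * μ s - φs)) :=
        mul_nonneg (by linarith) (mul_nonneg hs0.le (by linarith))
      have h8 : 0 ≤ (α - 1 - b) * (s * N) := mul_nonneg (by linarith) (mul_nonneg hs0.le hN)
      have h9 := mul_le_mul_of_nonneg_left h5 (show 0 ≤ b by linarith)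
      simp only [Nat.cast_ofNat, Nat.add_one_sub_one, pow_one, h6]
      nlinarith

lemma aux_nonneg {H : Type*} [NormedAddCommGroup H] [InnerProductSpace ℝ H] (d v : H) (t b α : ℝ)
    (hb : 0 ≤ b) (hbα : b ≤ α - 1) :
    0 ≤ 1 / 2 * t ^ 2 * ‖v‖ ^ 2 + b * (t * inner ℝ d v + (α - 1) / 2 * ‖d‖ ^ 2) := by
  have h1 : ‖t • v + b • d‖ ^ 2 = t ^ 2 * ‖v‖ ^ 2 + 2 * (t * (b * inner ℝ d v)) + b ^ 2 * ‖d‖ ^ 2 := by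
    rw [norm_add_sq_real, norm_smul, norm_smul, real_inner_smul_left, real_inner_smul_right,
      mul_pow, mul_pow, real_inner_comm]
    simp
  have h2 : 0 ≤ ‖t • v + b • d‖ ^ 2 := by positivity
  have h3 : 0 ≤ b * (α - 1 - b) * ‖d‖ ^ 2 :=
    mul_nonneg (mul_nonneg hb (by linarith)) (by positivity)
  nlinarith

theorem statement14 {H : Type*} [NormedAddCommGroup H] [InnerProductSpace ℝ H]
    [CompleteSpace H]
    (m : ℕ) (hm : 1 ≤ m)
    (g : Fin m → H → ℝ) (hg : ∀ i, ConvexOn ℝ Set.univ (g i))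
    (hgdiff : ∀ i, Differentiable ℝ (g i))
    -- each `∇ g i` is Lipschitz continuous on every bounded set
    (hgradLip : ∀ i, ∀ s : Set H, Bornology.IsBounded s →
      ∃ Li : ℝ, ∀ x ∈ s, ∀ y ∈ s,
        ‖gradient (g i) x - gradient (g i) y‖ ≤ Li * ‖x - y‖)
    (Q : Set (EuclideanSpace ℝ (Fin m))) (hQne : Q.Nonempty) (hQcomp : IsCompact Q)
    (hQconv : Convex ℝ Q) (hQpos : ∀ l ∈ Q, ∀ i, 0 ≤ l i)
    (D : EuclideanSpace ℝ (Fin m) → ℝ) (hDcont : Continuous D)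
    (hDnonneg : ∀ l ∈ Q, 0 ≤ D l)
    (σ : ℝ) (hσ : 0 < σ) (hDsc : StrongConvexOn Q σ D)
    (hDinf : IsGLB (D '' Q) 0)
    (C : ℝ) (hC : IsLUB (D '' Q) C)
    -- `D` is differentiable on a neighborhood `U` of `Q`
    (U : Set (EuclideanSpace ℝ (Fin m))) (hUopen : IsOpen U) (hQU : Q ⊆ U)
    (hDdiff : ∀ l ∈ U, DifferentiableAt ℝ D l)
    -- `argmin φ ≠ ∅`
    (hargmin : ∃ xs : H, ∀ y : H, phi m g Q xs ≤ phi m g Q y)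
    -- time data
    (t0 α : ℝ) (ht0 : 0 < t0) (hα : 3 < α)
    -- `μ` is continuously differentiable, positive and nonincreasing on `[t0, ∞)`
    (μ μ' : ℝ → ℝ) (hμpos : ∀ t ∈ Set.Ici t0, 0 < μ t)
    (hμderiv : ∀ t ∈ Set.Ici t0, HasDerivAt μ (μ' t) t)
    (hμ'cont : ContinuousOn μ' (Set.Ici t0))
    (hμanti : AntitoneOn μ (Set.Ici t0))
    -- `x` is a twice continuously differentiable solution of the inertial system
    (x x' x'' : ℝ → H)
    (hx' : ∀ t ∈ Set.Ici t0, HasDerivAt x (x' t) t)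
    (hx'' : ∀ t ∈ Set.Ici t0, HasDerivAt x' (x'' t) t)
    (hx''cont : ContinuousOn x'' (Set.Ici t0))
    (hODE : ∀ t ∈ Set.Ici t0,
      x'' t + (α / t) • x' t + gradient (phiMu m g Q D (μ t)) (x t) = 0)
    -- Assumption A
    (hA1 : MeasureTheory.IntegrableOn (fun t => t * μ t) (Set.Ioi t0))
    (hA2 : MeasureTheory.IntegrableOn (fun t => t ^ 2 * |μ' t|) (Set.Ioi t0))
 :
    ∀ z : H, (∀ y : H, phi m g Q z ≤ phi m g Q y) →
      ∃ L : ℝ, Filter.Tendsto (fun t => ‖x t - z‖) Filter.atTop (nhds L) := by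
  intro z hz
  have hDC : ∀ l ∈ Q, D l ≤ C := fun l hl => hC.1 ⟨l, hl, rfl⟩
  have hC0 : 0 ≤ C := by
    obtain ⟨l, hl⟩ := hQne
    exact (hDnonneg l hl).trans (hDC l hl)
  set T := t0 + 1 with hTdef
  have hT : 0 < T := by linarith
  have hTt : ∀ t ∈ Ici T, t0 < t := fun t ht => lt_of_lt_of_le (by linarith) (mem_Ici.1 ht)
  have hTI : ∀ t ∈ Ici T, t ∈ Ici t0 := fun t ht => (hTt t ht).le
  have hμc : ContinuousOn μ (Ici t0) := fun t ht => (hμderiv t ht).continuousAt.continuousWithinAt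
  set M : ℝ → ℝ := fun t => ∫ s in t0..t, s * μ s with hMdef
  have hMlim : Tendsto M atTop (nhds (∫ s in Ioi t0, s * μ s)) :=
    intervalIntegral_tendsto_integral_Ioi t0 hA1 tendsto_id
  have hM : ∀ t ∈ Ici T, HasDerivAt M (t * μ t) t := by
    intro t ht
    have hfc : ContinuousOn (fun s => s * μ s) (Ioi t0) :=
      continuousOn_id.mul (hμc.mono Ioi_subset_Ici_self)
    apply intervalIntegral.integral_hasDerivAt_right
    · rw [intervalIntegrable_iff_integrableOn_Ioc_of_le (hTt t ht).le]
      exact hA1.mono_set Ioc_subset_Ioi_self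
    · exact hfc.stronglyMeasurableAtFilter isOpen_Ioi t (hTt t ht)
    · exact hfc.continuousAt (Ioi_mem_nhds (hTt t ht))
  have hMb : ∀ t ∈ Ici T, M t ≤ ∫ s in Ioi t0, s * μ s := by
    intro t ht
    have hmono : MonotoneOn M (Ici T) := by
      have := aux_antitone (F := fun t => - M t) (T := T)
        (fun t ht => (hM t ht).neg.continuousAt.continuousWithinAt)
        (fun s hs => ⟨_, _, fun t _ => le_rfl, rfl, (hM s hs).neg, by
          have := mul_pos (lt_of_lt_of_le hT hs) (hμpos s (hTI s hs))
          linarith⟩)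
      intro a ha b hb hab
      have := this ha hb hab
      simp only at this
      linarith
    apply ge_of_tendsto hMlim
    filter_upwards [eventually_ge_atTop t] with s hs
    exact hmono ht (le_trans (mem_Ici.1 ht) hs) hs
  have q1 : ∀ t ∈ Ici T, ∀ y, phi m g Q z ≤ phiMu m g Q D (μ t) y + C * μ t := by
    intro t ht y
    refine (hz y).trans ?_
    rw [aux_phi D y]
    have := aux_mono2 (g := g) hQne hQcomp hDcont hDC (hμpos t (hTI t ht)).le y
    linarith
  have key : ∀ b, 2 ≤ b → b ≤ α - 1 → ∃ L, Tendsto (fun t =>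
      t ^ 2 * (phiMu m g Q D (μ t) (x t) + C * μ t - phi m g Q z) + 1 / 2 * t ^ 2 * ‖x' t‖ ^ 2
      + b * (t * inner ℝ (x t - z) (x' t) + (α - 1) / 2 * ‖x t - z‖ ^ 2) - b * C * M t)
      atTop (nhds L) := by
    intro b hb2 hbα
    have hanti := aux_dyn (P := fun t => phiMu m g Q D (μ t)) (T := T) (α := α) (C := C)
      (φs := phi m g Q z) (μ := μ) (M := M) (x := x) (x' := x') (x'' := x'') (z := z) hT
      (hμc.mono hTI) (fun t ht => hx' t (hTI t ht)) (fun t ht => hx'' t (hTI t ht))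
      (fun t ht => hODE t (hTI t ht)) hM
      (fun t ht y => aux_diff hQne hQcomp hDcont hQconv hgdiff hσ hDsc (hμpos t (hTI t ht)) y)
      (fun t ht y => aux_grad (aux_convex hQne hQcomp hDcont hg hQpos _)
        (aux_diff hQne hQcomp hDcont hQconv hgdiff hσ hDsc (hμpos t (hTI t ht)) y) z)
      (fun t ht => by
        rw [aux_phi D z]
        exact aux_mono hQne hQcomp hDcont hDnonneg (hμpos t (hTI t ht)).le z)
      q1
      (fun s hs t ht hst y => aux_mono2 hQne hQcomp hDcont hDC (hμanti (hTI s hs) (hTI t ht) hst) y)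
      (by
        intro s hs t ht y
        rcases le_total (μ t) (μ s) with h | h
        · have a1 := aux_mono (g := g) hQne hQcomp hDcont hDnonneg h y
          have a2 := aux_mono2 (g := g) hQne hQcomp hDcont hDC h y
          rw [abs_of_nonneg (sub_nonneg.2 a1), abs_of_nonpos (sub_nonpos.2 h)]
          linarith
        · have a1 := aux_mono (g := g) hQne hQcomp hDcont hDnonneg h y
          have a2 := aux_mono2 (g := g) hQne hQcomp hDcont hDC h y
          rw [abs_of_nonpos (sub_nonpos.2 a1), abs_of_nonneg (sub_nonneg.2 h)]
          linarith)
      hb2 hbα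
    refine aux_conv (B := - (b * C * ∫ s in Ioi t0, s * μ s)) hanti ?_
    intro t ht
    have a1 := aux_nonneg (x t - z) (x' t) t b α (by linarith) hbα
    have a2 : 0 ≤ t ^ 2 * (phiMu m g Q D (μ t) (x t) + C * μ t - phi m g Q z) :=
      mul_nonneg (sq_nonneg t) (sub_nonneg.2 (q1 t ht (x t)))
    have a3 := mul_le_mul_of_nonneg_left (hMb t ht) (mul_nonneg (show 0 ≤ b by linarith) hC0)
    linarith
  obtain ⟨L1, hL1⟩ := key 2 le_rfl (by linarith)
  obtain ⟨L2, hL2⟩ := key (α - 1) (by linarith) le_rfl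
  obtain ⟨W, hW⟩ : ∃ W, Tendsto (fun t => t * inner ℝ (x t - z) (x' t)
      + (α - 1) / 2 * ‖x t - z‖ ^ 2) atTop (nhds W) := by
    have h3 := ((hL2.sub hL1).const_mul (1 / (α - 3))).add (hMlim.const_mul C)
    refine ⟨_, h3.congr (fun t => ?_)⟩
    have : α - 3 ≠ 0 := by linarith
    field_simp
    ring
  have hlim : Tendsto (fun t => 1 / 2 * ‖x t - z‖ ^ 2) atTop (nhds (W / (α - 1))) := by
    have ha : 0 < α - 1 := by linarith
    refine aux_lim (T := T) (u' := fun t => inner ℝ (x t - z) (x' t)) ha ?_ ?_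
    · intro t ht
      refine ((((hx' t (hTI t ht)).sub_const z).norm_sq).const_mul (1 / 2)).congr_deriv ?_
      ring
    · rw [mul_div_cancel₀ _ ha.ne']
      refine hW.congr (fun t => by ring)
  refine ⟨Real.sqrt (2 * (W / (α - 1))), ?_⟩
  refine ((hlim.const_mul 2).sqrt).congr (fun t => ?_)
  rw [show 2 * (1 / 2 * ‖x t - z‖ ^ 2) = ‖x t - z‖ ^ 2 by ring]
  exact Real.sqrt_sq (norm_nonneg _)
end

section
/- Under Assumption A, if α > 3, then the regularized value gap decays faster than 1/t²: t² ( φ_{μ(t)}(x(t)) − inf φ ) → 0 as t → ∞ (in fact t² |φ_{μ(t)}(x(t)) − inf φ| → 0). -/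
open scoped BigOperators
open Set Filter MeasureTheory

lemma danskin {V : Type*} [NormedAddCommGroup V] [NormedSpace ℝ V]
    (K : Set (V →L[ℝ] ℝ)) (hK : IsCompact K) (v : V) (k0 : V →L[ℝ] ℝ) (hk0 : k0 ∈ K)
    (hmax : ∀ k ∈ K, k ≠ k0 → k v < k0 v) :
    HasFDerivAt (fun w : V => sSup ((fun k : V →L[ℝ] ℝ => k w) '' K)) k0 v := by
  have hcont : ∀ w : V, Continuous (fun k : V →L[ℝ] ℝ => k w) := fun w => by fun_prop
  have hbdd : ∀ w : V, BddAbove ((fun k : V →L[ℝ] ℝ => k w) '' K) := fun w =>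
    (hK.image (hcont w)).bddAbove
  have hex : ∀ w : V, ∃ k ∈ K, sSup ((fun k : V →L[ℝ] ℝ => k w) '' K) = k w := fun w => by
    obtain ⟨k, hk, h⟩ := hK.exists_sSup_image_eq ⟨k0, hk0⟩ (hcont w).continuousOn
    exact ⟨k, hk, h⟩
  choose kk hkK hkeq using hex
  have hle : ∀ w, ∀ k ∈ K, k w ≤ kk w w := fun w k hk => by
    rw [← hkeq]; exact le_csSup (hbdd w) ⟨k, hk, rfl⟩
  have hv : kk v = k0 := by
    by_contra h
    exact absurd (hle v k0 hk0) (not_le.2 (hmax _ (hkK v) h))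
  obtain ⟨M, hM0, hM⟩ : ∃ M : ℝ, 0 < M ∧ ∀ k ∈ K, ‖k‖ ≤ M := by
    obtain ⟨M, hM⟩ := hK.isBounded.exists_norm_le
    exact ⟨max M 1, by positivity, fun k hk => (hM k hk).trans (le_max_left _ _)⟩
  rw [hasFDerivAt_iff_isLittleO, Asymptotics.isLittleO_iff]
  intro ε hε
  -- maximizers are close
  have hclose : ∀ᶠ w in nhds v, ‖kk w - k0‖ < ε := by
    have hK' : IsCompact (K \ Metric.ball k0 ε) := hK.diff Metric.isOpen_ball
    have hδ : ∃ δ > 0, ∀ k ∈ K \ Metric.ball k0 ε, k v ≤ k0 v - δ := by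
      rcases (K \ Metric.ball k0 ε).eq_empty_or_nonempty with h | h
      · exact ⟨1, one_pos, by simp [h]⟩
      · obtain ⟨k1, hk1, h1⟩ := hK'.exists_isMaxOn h (hcont v).continuousOn
        refine ⟨k0 v - k1 v, ?_, fun k hk => ?_⟩
        · have : k1 ≠ k0 := by
            rintro rfl
            exact hk1.2 (Metric.mem_ball_self hε)
          linarith [hmax k1 hk1.1 this]
        · have := h1 hk
          simp only [mem_ofPred_eq] at this
          linarith
    obtain ⟨δ, hδ, hd⟩ := hδ
    filter_upwards [Metric.ball_mem_nhds v (show 0 < δ / (2 * M) by positivity)] with w hw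
    by_contra hcon
    have h1 := hd (kk w) ⟨hkK w, by simpa [dist_eq_norm] using hcon⟩
    have h2 := hle w k0 hk0
    have hn : ‖w - v‖ < δ / (2 * M) := by simpa [dist_eq_norm] using hw
    have hn' : 2 * (M * ‖w - v‖) < δ := by
      rw [lt_div_iff₀ (by positivity)] at hn; linarith
    have b : ∀ k ∈ K, |k w - k v| ≤ M * ‖w - v‖ := fun k hk => by
      rw [← map_sub, ← Real.norm_eq_abs]
      exact (k.le_opNorm _).trans (by gcongr; exact hM k hk)
    have b1 := abs_le.1 (b k0 hk0)
    have b2 := abs_le.1 (b _ (hkK w))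
    linarith
  filter_upwards [hclose] with w hw
  rw [hkeq w, hkeq v, hv, Real.norm_eq_abs, map_sub]
  have h1 := hle w k0 hk0
  have h2 := hle v (kk w) (hkK w)
  rw [hv] at h2
  have h3 : |(kk w - k0) (w - v)| ≤ ε * ‖w - v‖ := by
    rw [← Real.norm_eq_abs]
    exact ((kk w - k0).le_opNorm _).trans (by gcongr)
  simp only [sub_apply, map_sub] at h3
  rw [abs_le] at h3 ⊢
  constructor <;> [skip; linarith]
  have : 0 ≤ ε * ‖w - v‖ := by positivity
  linarith

noncomputable def ellMu (m : ℕ) (d : ℝ) (l : EuclideanSpace ℝ (Fin m)) :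
    ((Fin m → ℝ) × ℝ) →L[ℝ] ℝ :=
  (∑ i, l i • (ContinuousLinearMap.proj (R := ℝ) (φ := fun _ : Fin m => ℝ) i).comp
    (ContinuousLinearMap.fst ℝ (Fin m → ℝ) ℝ)) - d • ContinuousLinearMap.snd ℝ (Fin m → ℝ) ℝ

lemma ellMu_apply (m : ℕ) (d : ℝ) (l : EuclideanSpace ℝ (Fin m)) (p : (Fin m → ℝ) × ℝ) :
    ellMu m d l p = ∑ i, l i * p.1 i - p.2 * d := by
  simp [ellMu, mul_comm]

lemma supDeriv (m : ℕ) (Q : Set (EuclideanSpace ℝ (Fin m))) (hQne : Q.Nonempty)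
    (hQcomp : IsCompact Q) (hQconv : Convex ℝ Q)
    (D : EuclideanSpace ℝ (Fin m) → ℝ) (hDcont : Continuous D)
    (σ : ℝ) (hσ : 0 < σ) (hDsc : StrongConvexOn Q σ D) (p : (Fin m → ℝ) × ℝ) (hp : 0 < p.2) :
    ∃ l ∈ Q, (sSup ((fun l : EuclideanSpace ℝ (Fin m) => ∑ i, l i * p.1 i - p.2 * D l) '' Q)
        = ∑ i, l i * p.1 i - p.2 * D l) ∧
      HasFDerivAt (fun q : (Fin m → ℝ) × ℝ =>
        sSup ((fun l : EuclideanSpace ℝ (Fin m) => ∑ i, l i * q.1 i - q.2 * D l) '' Q))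
        (ellMu m (D l) l) p := by
  have hc : Continuous (fun l : EuclideanSpace ℝ (Fin m) => ∑ i, l i * p.1 i - p.2 * D l) := by
    fun_prop
  obtain ⟨l0, hl0, hm0⟩ := hQcomp.exists_isMaxOn hQne hc.continuousOn
  have hm0' : ∀ l ∈ Q, ∑ i, l i * p.1 i - p.2 * D l ≤ ∑ i, l0 i * p.1 i - p.2 * D l0 :=
    fun l hl => hm0 hl
  refine ⟨l0, hl0, ?_, ?_⟩
  · exact IsGreatest.csSup_eq ⟨⟨l0, hl0, rfl⟩, by rintro _ ⟨l, hl, rfl⟩; exact hm0' l hl⟩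
  have hK : IsCompact ((fun l => ellMu m (D l) l) '' Q) := by
    apply hQcomp.image
    unfold ellMu
    fun_prop
  have := danskin _ hK p (ellMu m (D l0) l0) ⟨l0, hl0, rfl⟩ ?_
  · simpa only [image_image, ellMu_apply] using this
  rintro _ ⟨l, hl, rfl⟩ hne
  have hne' : l ≠ l0 := by rintro rfl; exact hne rfl
  simp only [ellMu_apply]
  by_contra hcon
  have hs := hDsc.2 hl hl0 (show (0:ℝ) ≤ 1/2 by norm_num) (show (0:ℝ) ≤ 1/2 by norm_num)
    (by norm_num)
  have hmid := hm0' _ (hQconv hl hl0 (show (0:ℝ) ≤ 1/2 by norm_num)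
    (show (0:ℝ) ≤ 1/2 by norm_num) (by norm_num))
  have hsum : ∑ i, ((1/2:ℝ) • l + (1/2:ℝ) • l0) i * p.1 i
      = 1/2 * ∑ i, l i * p.1 i + 1/2 * ∑ i, l0 i * p.1 i := by
    rw [Finset.mul_sum, Finset.mul_sum, ← Finset.sum_add_distrib]
    refine Finset.sum_congr rfl fun i _ => ?_
    simp; ring
  rw [hsum] at hmid
  have hpos : 0 < ‖l - l0‖ := norm_pos_iff.2 (sub_ne_zero.2 hne')
  simp only [smul_eq_mul] at hs
  have hpos2 : 0 < 1/2 * (1/2) * (σ / 2 * ‖l - l0‖ ^ 2) := by positivity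
  have h5 : D ((1/2:ℝ) • l + (1/2:ℝ) • l0) < 1/2 * D l + 1/2 * D l0 := by linarith
  have h6 := mul_lt_mul_of_pos_left h5 hp
  have := hm0' l hl
  linarith

lemma convex_grad {H : Type*} [NormedAddCommGroup H] [InnerProductSpace ℝ H] [CompleteSpace H]
    (f : H → ℝ) (hf : ConvexOn ℝ Set.univ f) (x y : H) (f' : H →L[ℝ] ℝ) (hd : HasFDerivAt f f' x) :
    f x + f' (y - x) ≤ f y := by
  have h1 : ConvexOn ℝ Set.univ (f ∘ AffineMap.lineMap (k := ℝ) x y) := by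
    simpa using hf.comp_affineMap (AffineMap.lineMap (k := ℝ) x y)
  have h2 : HasDerivAt (f ∘ AffineMap.lineMap (k := ℝ) x y) (f' (y - x)) 0 := by
    apply HasFDerivAt.comp_hasDerivAt (𝕜 := ℝ)
    · simpa using hd
    · exact AffineMap.hasDerivAt_lineMap
  have h3 := h1.le_slope_of_hasDerivAt (mem_univ 0) (mem_univ 1) zero_lt_one h2
  simp [slope_def_field, -map_sub] at h3
  linarith

lemma real_core (t1 c B : ℝ) (ht1 : 0 < t1) (hc : 0 < c) (G N E E' P' r R : ℝ → ℝ)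
    (hG : ∀ t ≥ t1, 0 ≤ G t) (hN : ∀ t ≥ t1, 0 ≤ N t) (hE : ∀ t ≥ t1, 0 ≤ E t)
    (hE' : ∀ t ≥ t1, HasDerivAt E (E' t) t)
    (hEle : ∀ t ≥ t1, E' t ≤ - c * (t * (G t + N t)) + r t)
    (hP' : ∀ t ≥ t1, HasDerivAt (fun t => t ^ 2 * (G t + N t / 2)) (P' t) t)
    (hPle : ∀ t ≥ t1, P' t ≤ 2 * t * G t)
    (hR : ∀ t ≥ t1, HasDerivAt R (r t) t) (hRB : ∀ t ≥ t1, R t ≤ B) :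
    Tendsto (fun t => t ^ 2 * (G t + N t / 2)) atTop (nhds 0) := by
  -- general antitone lemma
  have anti : ∀ (s : ℝ) (f f' : ℝ → ℝ), (∀ t ≥ s, HasDerivAt f (f' t) t) → (∀ t ≥ s, f' t ≤ 0) →
      AntitoneOn f (Ici s) := by
    intro s f f' h1 h2
    apply antitoneOn_of_deriv_nonpos (convex_Ici s)
    · exact fun t ht => (h1 t ht).continuousAt.continuousWithinAt
    · intro t ht
      rw [interior_Ici] at ht
      exact (h1 t ht.le).differentiableAt.differentiableWithinAt
    · intro t ht
      rw [interior_Ici] at ht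
      rw [(h1 t ht.le).deriv]; exact h2 t ht.le
  have conv : ∀ (f : ℝ → ℝ) (b : ℝ), AntitoneOn f (Ici t1) → (∀ t ≥ t1, b ≤ f t) →
      ∃ l, Tendsto f atTop (nhds l) := by
    intro f b h1 h2
    have ha : Antitone (fun t => f (max t t1)) := fun a b hab =>
      h1 (mem_Ici.2 (le_max_right _ _)) (mem_Ici.2 (le_max_right _ _)) (max_le_max_right _ hab)
    refine ⟨_, (tendsto_atTop_ciInf ha ⟨b, ?_⟩).congr' ?_⟩
    · rintro _ ⟨t, rfl⟩; exact h2 _ (le_max_right _ _)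
    · filter_upwards [eventually_ge_atTop t1] with t ht
      rw [max_eq_left ht]
  have hZd : ∀ t ≥ t1, HasDerivAt (fun t => E t - R t) (E' t - r t) t := fun t ht =>
    (hE' t ht).sub (hR t ht)
  have hZb : ∀ t ≥ t1, -B ≤ E t - R t := fun t ht => by linarith [hE t ht, hRB t ht]
  obtain ⟨z, hz⟩ := conv _ _ (anti t1 _ _ hZd fun t ht => by
    have : 0 ≤ c * (t * (G t + N t)) := by
      have := hG t ht; have := hN t ht; have : 0 < t := ht1.trans_le ht
      positivity
    linarith [hEle t ht]) hZb
  have hPn : ∀ t ≥ t1, 0 ≤ t ^ 2 * (G t + N t / 2) := fun t ht => by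
    have := hG t ht; have := hN t ht; positivity
  obtain ⟨w, hw⟩ := conv (fun t => t ^ 2 * (G t + N t / 2) + (2 / c) * (E t - R t)) ((2 / c) * (-B))
    (anti t1 _ _ (fun t ht => (hP' t ht).add ((hZd t ht).const_mul (2 / c))) (fun t ht => by
      have h1 := hPle t ht
      have h2 : E' t - r t ≤ - c * (t * (G t + N t)) := by linarith [hEle t ht]
      have h3 := mul_le_mul_of_nonneg_left h2 (show 0 ≤ 2 / c by positivity)
      have h4 : 2 / c * (- c * (t * (G t + N t))) = - 2 * (t * G t) - 2 * (t * N t) := by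
        field_simp; ring
      have h5 : 0 ≤ t * N t := mul_nonneg (ht1.le.trans ht) (hN t ht)
      linarith)) (fun t ht => by
      have h3 := mul_le_mul_of_nonneg_left (hZb t ht) (show 0 ≤ 2 / c by positivity)
      linarith [hPn t ht])
  have hP : Tendsto (fun t => t ^ 2 * (G t + N t / 2)) atTop (nhds (w - 2 / c * z)) := by
    refine (hw.sub (hz.const_mul (2 / c))).congr fun t => ?_
    ring
  set p := w - 2 / c * z
  have hp0 : 0 ≤ p := ge_of_tendsto hP (by
    filter_upwards [eventually_ge_atTop t1] with t ht using hPn t ht)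
  rcases hp0.eq_or_lt with h | h
  · rwa [h]
  exfalso
  obtain ⟨s, hs⟩ := eventually_atTop.1 (hP.eventually (eventually_ge_nhds (half_lt_self h)))
  set s' := max s t1
  have hlog : AntitoneOn (fun t => (E t - R t) + (c * (p / 2)) * Real.log t) (Ici s') := by
    refine anti s' _ _ (fun t ht => (hZd t ((le_max_right _ _).trans ht)).add
      ((Real.hasDerivAt_log ?_).const_mul (c * (p / 2)))) fun t ht => ?_
    · exact (ht1.trans_le ((le_max_right _ _).trans ht)).ne'
    · have htt : t1 ≤ t := (le_max_right _ _).trans ht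
      have ht0 : 0 < t := ht1.trans_le htt
      have h1 := hs t ((le_max_left _ _).trans ht)
      have h2 : p / 2 * t⁻¹ ≤ t * (G t + N t) := by
        rw [← div_eq_mul_inv, div_le_iff₀ ht0]
        have : 0 ≤ t ^ 2 * N t := mul_nonneg (by positivity) (hN t htt)
        nlinarith
      have h3 := mul_le_mul_of_nonneg_left h2 hc.le
      linarith [hEle t htt]
  have hinf : Tendsto (fun t => (E t - R t) + (c * (p / 2)) * Real.log t) atTop atTop :=
    hz.add_atTop (Real.tendsto_log_atTop.const_mul_atTop (by positivity))
  obtain ⟨t, ht, ht'⟩ := ((hinf.eventually_gt_atTop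
    ((E s' - R s') + (c * (p / 2)) * Real.log s')).and (eventually_ge_atTop s')).exists
  exact absurd (hlog (mem_Ici.2 le_rfl) ht' ht') (not_le.2 ht)

lemma mu_core (t0 : ℝ) (ht0 : 0 < t0) (μ : ℝ → ℝ) (hpos : ∀ t ∈ Ici t0, 0 < μ t)
    (hcont : ContinuousOn μ (Ici t0)) (hanti : AntitoneOn μ (Ici t0))
    (hA : IntegrableOn (fun t => t * μ t) (Ioi t0)) :
    ∃ (R : ℝ → ℝ) (B : ℝ), (∀ t > t0, HasDerivAt R (t * μ t) t) ∧ (∀ t > t0, R t ≤ B) ∧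
      Tendsto (fun t => t ^ 2 * μ t) atTop (nhds 0) := by
  have hc : ContinuousOn (fun t => t * μ t) (Ici t0) := continuousOn_id.mul hcont
  have hd : ∀ t > t0, HasDerivAt (fun u => ∫ s in t0..u, s * μ s) (t * μ t) t := by
    intro t ht
    apply intervalIntegral.integral_hasDerivAt_right
    · rw [intervalIntegrable_iff_integrableOn_Ioc_of_le ht.le]
      exact hA.mono_set Ioc_subset_Ioi_self
    · exact (hc.mono Ioi_subset_Ici_self).stronglyMeasurableAtFilter isOpen_Ioi t ht
    · exact hc.continuousAt (Ici_mem_nhds ht)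
  have hlim := intervalIntegral_tendsto_integral_Ioi t0 hA tendsto_id
  simp only [id] at hlim
  refine ⟨_, ∫ s in Ioi t0, s * μ s, hd, ?_, ?_⟩
  · intro t ht
    rw [intervalIntegral.integral_of_le ht.le]
    apply setIntegral_mono_set hA
    · filter_upwards [ae_restrict_mem measurableSet_Ioi] with s hs
      exact mul_nonneg (ht0.trans hs).le (hpos s (mem_Ici.2 (le_of_lt hs))).le
    · exact (Ioc_subset_Ioi_self).eventuallyLE
  · have h2 : Tendsto (fun t : ℝ => t / 2) atTop atTop := tendsto_id.atTop_div_const two_pos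
    have h3 := (hlim.sub (hlim.comp h2)).const_mul 4
    simp only [sub_self, mul_zero] at h3
    refine squeeze_zero' ?_ ?_ h3
    · filter_upwards [eventually_ge_atTop t0] with t ht
      have := hpos t ht
      positivity
    · filter_upwards [eventually_gt_atTop (2 * t0)] with t ht
      have hlt : t / 2 < t := by linarith
      obtain ⟨ξ, hξ, he⟩ := exists_hasDerivAt_eq_slope (fun u => ∫ s in t0..u, s * μ s)
        (fun t => t * μ t) hlt
        (fun u hu => (hd u (by have := hu.1; show t0 < u; linarith)).continuousAt.continuousWithinAt)
        (fun u hu => hd u (by have := hu.1; show t0 < u; linarith))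
      rw [eq_div_iff (by linarith)] at he
      simp only [Function.comp]
      rw [← he]
      have h1 : μ t ≤ μ ξ := hanti (by have := hξ.1; show t0 ≤ ξ; linarith)
        (by show t0 ≤ t; linarith) hξ.2.le
      have h0 := hpos t (by show t0 ≤ t; linarith)
      have h5 : t / 2 * μ t ≤ ξ * μ ξ := mul_le_mul hξ.1.le h1 h0.le (by linarith [hξ.1])
      have := mul_le_mul_of_nonneg_right h5 (show 0 ≤ t - t / 2 by linarith)
      linarith

lemma grad_step {H : Type*} [NormedAddCommGroup H] [InnerProductSpace ℝ H] [CompleteSpace H]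
    (m : ℕ) (g : Fin m → H → ℝ) (hg : ∀ i, ConvexOn ℝ Set.univ (g i))
    (hgdiff : ∀ i, Differentiable ℝ (g i))
    (Q : Set (EuclideanSpace ℝ (Fin m))) (hQne : Q.Nonempty) (hQcomp : IsCompact Q)
    (hQconv : Convex ℝ Q) (hQpos : ∀ l ∈ Q, ∀ i, 0 ≤ l i)
    (D : EuclideanSpace ℝ (Fin m) → ℝ) (hDcont : Continuous D)
    (σ : ℝ) (hσ : 0 < σ) (hDsc : StrongConvexOn Q σ D)
    (μ : ℝ → ℝ) (x : ℝ → H) (t a : ℝ) (v : H) (hμ0 : 0 < μ t) (hμ : HasDerivAt μ a t)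
    (hx : HasDerivAt x v t) :
    ∃ l ∈ Q, HasDerivAt (fun s => phiMu m g Q D (μ s) (x s))
        (inner ℝ (gradient (phiMu m g Q D (μ t)) (x t)) v - a * D l) t ∧
      ∀ y, phiMu m g Q D (μ t) (x t) + inner ℝ (gradient (phiMu m g Q D (μ t)) (x t)) (y - x t)
        ≤ phiMu m g Q D (μ t) y := by
  obtain ⟨l, hl, heq, hd⟩ := supDeriv m Q hQne hQcomp hQconv D hDcont σ hσ hDsc
    (fun i => g i (x t), μ t) hμ0
  have hpi : HasFDerivAt (fun y : H => fun i => g i y)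
      (ContinuousLinearMap.pi fun i => fderiv ℝ (g i) (x t)) (x t) :=
    hasFDerivAt_pi.2 fun i => (hgdiff i (x t)).hasFDerivAt
  have h1 : HasFDerivAt (phiMu m g Q D (μ t)) _ (x t) :=
    HasFDerivAt.comp (x t) (f := fun y : H => ((fun i => g i y), μ t)) hd
      (hpi.prodMk (hasFDerivAt_const (μ t) (x t)))
  have hin : ∀ w, inner ℝ (gradient (phiMu m g Q D (μ t)) (x t)) w
      = ∑ i, l i * fderiv ℝ (g i) (x t) w := fun w => by
    rw [h1.hasGradientAt.gradient, InnerProductSpace.toDual_symm_apply]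
    simp [ellMu_apply]
  refine ⟨l, hl, ?_, fun y => ?_⟩
  · have h2 : HasDerivAt (fun s => phiMu m g Q D (μ s) (x s)) _ t :=
      HasFDerivAt.comp_hasDerivAt t (f := fun s : ℝ => ((fun i => g i (x s)), μ s)) hd
        ((hpi.comp_hasDerivAt t hx).prodMk hμ)
    convert h2 using 1
    rw [hin]
    simp [ellMu_apply]
  · have hval : phiMu m g Q D (μ t) (x t) = ∑ i, l i * g i (x t) - μ t * D l := heq
    have hbd : ∑ i, l i * g i y - μ t * D l ≤ phiMu m g Q D (μ t) y := by
      apply le_csSup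
      · exact (hQcomp.image (by fun_prop)).bddAbove
      · exact ⟨l, hl, rfl⟩
    refine le_trans ?_ hbd
    rw [hval, hin]
    have : ∑ i, l i * g i (x t) + ∑ i, l i * fderiv ℝ (g i) (x t) (y - x t)
        ≤ ∑ i, l i * g i y := by
      rw [← Finset.sum_add_distrib]
      refine Finset.sum_le_sum fun i _ => ?_
      rw [← mul_add]
      exact mul_le_mul_of_nonneg_left
        (convex_grad (g i) (hg i) (x t) y _ (hgdiff i (x t)).hasFDerivAt) (hQpos l hl i)
    linarith

theorem statement15 {H : Type*} [NormedAddCommGroup H] [InnerProductSpace ℝ H]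
    [CompleteSpace H]
    (m : ℕ) (hm : 1 ≤ m)
    (g : Fin m → H → ℝ) (hg : ∀ i, ConvexOn ℝ Set.univ (g i))
    (hgdiff : ∀ i, Differentiable ℝ (g i))
    -- each `∇ g i` is Lipschitz continuous on every bounded set
    (hgradLip : ∀ i, ∀ s : Set H, Bornology.IsBounded s →
      ∃ Li : ℝ, ∀ x ∈ s, ∀ y ∈ s,
        ‖gradient (g i) x - gradient (g i) y‖ ≤ Li * ‖x - y‖)
    (Q : Set (EuclideanSpace ℝ (Fin m))) (hQne : Q.Nonempty) (hQcomp : IsCompact Q)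
    (hQconv : Convex ℝ Q) (hQpos : ∀ l ∈ Q, ∀ i, 0 ≤ l i)
    (D : EuclideanSpace ℝ (Fin m) → ℝ) (hDcont : Continuous D)
    (hDnonneg : ∀ l ∈ Q, 0 ≤ D l)
    (σ : ℝ) (hσ : 0 < σ) (hDsc : StrongConvexOn Q σ D)
    (hDinf : IsGLB (D '' Q) 0)
    (C : ℝ) (hC : IsLUB (D '' Q) C)
    -- `D` is differentiable on a neighborhood `U` of `Q`
    (U : Set (EuclideanSpace ℝ (Fin m))) (hUopen : IsOpen U) (hQU : Q ⊆ U)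
    (hDdiff : ∀ l ∈ U, DifferentiableAt ℝ D l)
    -- `xstar` is a minimizer of `φ` (so `inf φ = φ xstar`)
    (xstar : H) (hstar : ∀ y : H, phi m g Q xstar ≤ phi m g Q y)
    -- time data
    (t0 α : ℝ) (ht0 : 0 < t0) (hα : 3 < α)
    -- `μ` is continuously differentiable, positive and nonincreasing on `[t0, ∞)`
    (μ μ' : ℝ → ℝ) (hμpos : ∀ t ∈ Set.Ici t0, 0 < μ t)
    (hμderiv : ∀ t ∈ Set.Ici t0, HasDerivAt μ (μ' t) t)
    (hμ'cont : ContinuousOn μ' (Set.Ici t0))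
    (hμanti : AntitoneOn μ (Set.Ici t0))
    -- `x` is a twice continuously differentiable solution of the inertial system
    (x x' x'' : ℝ → H)
    (hx' : ∀ t ∈ Set.Ici t0, HasDerivAt x (x' t) t)
    (hx'' : ∀ t ∈ Set.Ici t0, HasDerivAt x' (x'' t) t)
    (hx''cont : ContinuousOn x'' (Set.Ici t0))
    (hODE : ∀ t ∈ Set.Ici t0,
      x'' t + (α / t) • x' t + gradient (phiMu m g Q D (μ t)) (x t) = 0)
    -- Assumption A
    (hA1 : MeasureTheory.IntegrableOn (fun t => t * μ t) (Set.Ioi t0))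
    (hA2 : MeasureTheory.IntegrableOn (fun t => t ^ 2 * |μ' t|) (Set.Ioi t0))
 :
    Filter.Tendsto
      (fun t => t ^ 2 * |phiMu m g Q D (μ t) (x t) - phi m g Q xstar|)
      Filter.atTop (nhds 0) := by
  have hC1 : ∀ l ∈ Q, D l ≤ C := fun l hl => hC.1 ⟨l, hl, rfl⟩
  have hC0 : 0 ≤ C := by
    obtain ⟨l, hl⟩ := hQne
    exact (hDnonneg l hl).trans (hC1 l hl)
  have hbphi : ∀ y, BddAbove ((fun l : EuclideanSpace ℝ (Fin m) => ∑ i, l i * g i y) '' Q) :=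
    fun y => (hQcomp.image (by fun_prop)).bddAbove
  have hbmu : ∀ a y, BddAbove
      ((fun l : EuclideanSpace ℝ (Fin m) => ∑ i, l i * g i y - a * D l) '' Q) :=
    fun a y => (hQcomp.image (by fun_prop)).bddAbove
  have hle1 : ∀ a ≥ 0, ∀ y, phiMu m g Q D a y ≤ phi m g Q y := fun a ha y => by
    apply csSup_le (hQne.image _)
    rintro _ ⟨l, hl, rfl⟩
    have := mul_nonneg ha (hDnonneg l hl)
    have h2 : ∑ i, l i * g i y ≤ phi m g Q y := le_csSup (hbphi y) ⟨l, hl, rfl⟩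
    simp only
    linarith
  have hle2 : ∀ a ≥ 0, ∀ y, phi m g Q y ≤ phiMu m g Q D a y + C * a := fun a ha y => by
    apply csSup_le (hQne.image _)
    rintro _ ⟨l, hl, rfl⟩
    have := mul_le_mul_of_nonneg_left (hC1 l hl) ha
    have h2 : ∑ i, l i * g i y - a * D l ≤ phiMu m g Q D a y :=
      le_csSup (hbmu a y) ⟨l, hl, rfl⟩
    simp only
    linarith
  have hμ'np : ∀ t ∈ Set.Ici t0, μ' t ≤ 0 := fun t ht => by
    rw [← (hμderiv t ht).hasDerivWithinAt.derivWithin (uniqueDiffOn_Ici t0 t ht)]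
    exact hμanti.derivWithin_nonpos
  obtain ⟨R, B, hR, hRB, hμlim⟩ := mu_core t0 ht0 μ hμpos
    (fun t ht => (hμderiv t ht).continuousAt.continuousWithinAt) hμanti hA1
  have hstep : ∀ t ∈ Set.Ici t0, _ := fun t ht => grad_step m g hg hgdiff Q hQne hQcomp hQconv
    hQpos D hDcont σ hσ hDsc μ x t (μ' t) (x' t) (hμpos t ht) (hμderiv t ht) (hx' t ht)
  choose! l hlQ hF hsub using hstep
  set φs := phi m g Q xstar with hφs
  set F : ℝ → ℝ := fun s => phiMu m g Q D (μ s) (x s) with hFdef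
  set v : ℝ → H := fun t => gradient (phiMu m g Q D (μ t)) (x t) with hv
  set b : ℝ := (α + 1) / 2 with hb
  set G : ℝ → ℝ := fun t => F t - φs + C * μ t with hG
  have hG0 : ∀ t ∈ Set.Ici t0, 0 ≤ G t := fun t ht => by
    have h1 := hle2 (μ t) (hμpos t ht).le (x t)
    have h2 := hstar (x t)
    simp only [hG, hFdef]; linarith
  have hGd : ∀ t ∈ Set.Ici t0,
      HasDerivAt G (inner ℝ (v t) (x' t) + μ' t * (C - D (l t))) t := fun t ht => by
    have := ((hF t ht).sub_const φs).add ((hμderiv t ht).const_mul C)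
    refine this.congr_deriv ?_
    ring
  have hsub' : ∀ t ∈ Set.Ici t0, G t - C * μ t ≤ inner ℝ (v t) (x t - xstar) := fun t ht => by
    have h1 := hsub t ht xstar
    have h2 := hle1 (μ t) (hμpos t ht).le xstar
    rw [← neg_sub (x t) xstar, inner_neg_right] at h1
    simp only [hG, hFdef]
    linarith
  have hmuD : ∀ t ∈ Set.Ici t0, t ^ 2 * (μ' t * (C - D (l t))) ≤ 0 := fun t ht =>
    mul_nonpos_of_nonneg_of_nonpos (by positivity)
      (mul_nonpos_of_nonpos_of_nonneg (hμ'np t ht) (by linarith [hC1 _ (hlQ t ht)]))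
  have hxx : ∀ t ∈ Set.Ici t0, t • x'' t = - (α • x' t) - t • v t := fun t ht => by
    have htp : t ≠ 0 := (ht0.trans_le ht).ne'
    have h1 := congrArg (fun z => t • z) (hODE t ht)
    simp only [smul_add, smul_smul, smul_zero, mul_div_cancel₀ _ htp] at h1
    rw [show t • x'' t = - (α • x' t) - t • v t ↔
      t • x'' t + α • x' t + t • v t = 0 from ?_]
    · exact h1
    · constructor
      · intro h; rw [h]; abel
      · intro h
        rw [← sub_eq_zero, ← h]; abel
  have hNd : ∀ t ∈ Set.Ici t0, HasDerivAt (fun t => ‖x' t‖ ^ 2) (2 * inner ℝ (x' t) (x'' t)) t :=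
    fun t ht => (hx'' t ht).norm_sq
  have htN : ∀ t ∈ Set.Ici t0,
      t * inner ℝ (x' t) (x'' t) = - α * ‖x' t‖ ^ 2 - t * inner ℝ (v t) (x' t) := fun t ht => by
    rw [← real_inner_smul_right, hxx t ht, inner_sub_right, inner_neg_right, real_inner_smul_right,
      real_inner_smul_right, real_inner_self_eq_norm_sq, real_inner_comm]
    ring
  have hPd : ∀ t ∈ Set.Ici t0, HasDerivAt (fun t => t ^ 2 * (G t + ‖x' t‖ ^ 2 / 2))
      (2 * t * G t + (1 - α) * t * ‖x' t‖ ^ 2 + t ^ 2 * (μ' t * (C - D (l t)))) t := fun t ht => by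
    have h1 := (hasDerivAt_pow 2 t).mul ((hGd t ht).add ((hNd t ht).div_const 2))
    refine h1.congr_deriv ?_
    have := htN t ht
    simp only [Pi.add_apply]
    push_cast
    linear_combination t * this
  set E : ℝ → ℝ := fun t => t ^ 2 * G t + ‖b • (x t - xstar) + t • x' t‖ ^ 2 / 2
    + b * (α - 1 - b) / 2 * ‖x t - xstar‖ ^ 2 with hE
  have hEd : ∀ t ∈ Set.Ici t0, HasDerivAt E
      (2 * t * G t + t ^ 2 * (μ' t * (C - D (l t))) - b * t * inner ℝ (v t) (x t - xstar)
        - (α - 1 - b) * t * ‖x' t‖ ^ 2) t := fun t ht => by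
    have hd := (hx' t ht).sub_const xstar
    have h0 := (hd.const_smul b).add ((hasDerivAt_id t).smul (hx'' t ht))
    have h1 := (((hasDerivAt_pow 2 t).mul (hGd t ht)).add (h0.norm_sq.div_const 2)).add
      (hd.norm_sq.const_mul (b * (α - 1 - b) / 2))
    refine h1.congr_deriv ?_
    simp only [Pi.add_apply, Pi.smul_apply, Pi.smul_apply', id, hxx t ht]
    simp only [inner_add_left, inner_add_right, inner_sub_right, inner_neg_right,
      real_inner_smul_left, real_inner_smul_right, real_inner_self_eq_norm_sq, one_smul]
    rw [real_inner_comm (v t) (x' t), real_inner_comm (v t) (x t - xstar), ← inner_sub_right]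
    push_cast
    ring
  have key := real_core (t0 + 1) ((α - 3) / 2) (b * C * B) (by linarith) (by linarith) G
    (fun t => ‖x' t‖ ^ 2) E _ _ (fun t => b * C * (t * μ t)) (fun t => b * C * R t)
    (fun t ht => hG0 t (mem_Ici.2 (by linarith)))
    (fun t ht => by positivity)
    (fun t ht => by
      have htm : t ∈ Set.Ici t0 := mem_Ici.2 (by linarith)
      have h1 := hG0 t htm
      have h2 : 0 ≤ b * (α - 1 - b) := mul_nonneg (by linarith) (by linarith)
      simp only [hE]
      positivity)
    (fun t ht => hEd t (mem_Ici.2 (by linarith)))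
    (fun t ht => by
      have htm : t ∈ Set.Ici t0 := mem_Ici.2 (by linarith)
      have h1 := hmuD t htm
      have h2 := mul_le_mul_of_nonneg_left (hsub' t htm)
        (show 0 ≤ b * t from mul_nonneg (by linarith) (by linarith))
      have h3 : b * t * G t = 2 * t * G t + (α - 3) / 2 * (t * G t) := by rw [hb]; ring
      have h4 : (α - 1 - b) * t * ‖x' t‖ ^ 2 = (α - 3) / 2 * (t * ‖x' t‖ ^ 2) := by rw [hb]; ring
      linarith)
    (fun t ht => hPd t (mem_Ici.2 (by linarith)))
    (fun t ht => by
      have htm : t ∈ Set.Ici t0 := mem_Ici.2 (by linarith)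
      have h1 := hmuD t htm
      have h2 : 0 ≤ (α - 1) * t * ‖x' t‖ ^ 2 :=
        mul_nonneg (mul_nonneg (by linarith) (by linarith)) (by positivity)
      linarith)
    (fun t ht => (hR t (by linarith)).const_mul (b * C))
    (fun t ht => mul_le_mul_of_nonneg_left (hRB t (by linarith))
      (mul_nonneg (by linarith) hC0))
  have hfin := key.add (hμlim.const_mul C)
  simp only [mul_zero, add_zero] at hfin
  refine squeeze_zero' (Eventually.of_forall fun t => by positivity) ?_ hfin
  filter_upwards [eventually_ge_atTop t0] with t ht
  have h1 := hG0 t ht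
  have h2 := hμpos t ht
  have h3 : |F t - φs| ≤ G t + ‖x' t‖ ^ 2 / 2 + C * μ t := by
    have h4 : 0 ≤ C * μ t := by positivity
    have h5 : 0 ≤ ‖x' t‖ ^ 2 / 2 := by positivity
    have h6 : G t = F t - φs + C * μ t := rfl
    rw [abs_le]
    constructor <;> linarith
  have := mul_le_mul_of_nonneg_left h3 (sq_nonneg t)
  linarith
end

section
/- Under Assumption A, if α > 3, then the velocity decays faster than 1/t: t‖ẋ(t)‖ → 0 as t → ∞. -/
open scoped BigOperators
open Set Filter MeasureTheory

lemma aux_anti {t0 : ℝ} {f f' : ℝ → ℝ} (h : ∀ t ∈ Ici t0, HasDerivAt f (f' t) t)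
    (h0 : ∀ t ∈ Ici t0, f' t ≤ 0) : AntitoneOn f (Ici t0) := by
  apply antitoneOn_of_deriv_nonpos (convex_Ici t0)
  · exact fun t ht => (h t ht).continuousAt.continuousWithinAt
  · exact fun t ht => (h t (interior_subset ht)).differentiableAt.differentiableWithinAt
  · intro t ht
    rw [(h t (interior_subset ht)).deriv]
    exact h0 t (interior_subset ht)

lemma aux_prim {t0 : ℝ} {f : ℝ → ℝ} (h : ContinuousOn f (Ici t0)) :
    ∃ F : ℝ → ℝ, F t0 = 0 ∧ (∀ t ∈ Ici t0, HasDerivAt F (f t) t) ∧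
      ∀ t ∈ Ici t0, F t = ∫ s in t0..t, f s := by
  have hc : Continuous (fun s => f (max s t0)) := by
    apply h.comp_continuous (by fun_prop : Continuous fun s : ℝ => max s t0)
    intro s
    exact mem_Ici.2 (le_max_right _ _)
  refine ⟨fun t => ∫ s in t0..t, f (max s t0), by simp, ?_, ?_⟩
  · intro t ht
    have := intervalIntegral.integral_hasDerivAt_right (hc.intervalIntegrable t0 t)
      (hc.stronglyMeasurableAtFilter _ _) hc.continuousAt
    simpa [max_eq_left (show t0 ≤ t from ht)] using this
  · intro t ht
    apply intervalIntegral.integral_congr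
    intro s hs
    rw [uIcc_of_le (show t0 ≤ t from ht)] at hs
    simp [max_eq_left hs.1]

lemma aux_conv_s17 {t0 B : ℝ} {f : ℝ → ℝ} (h : AntitoneOn f (Ici t0)) (hb : ∀ t ∈ Ici t0, B ≤ f t) :
    ∃ l, Tendsto f atTop (nhds l) := by
  have ha : Antitone (fun t => f (max t t0)) := by
    intro a b hab
    exact h (mem_Ici.2 (le_max_right _ _)) (mem_Ici.2 (le_max_right _ _)) (max_le_max_right _ hab)
  refine ⟨_, (tendsto_atTop_ciInf ha ⟨B, ?_⟩).congr' ?_⟩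
  · rintro _ ⟨t, rfl⟩
    exact hb _ (mem_Ici.2 (le_max_right _ _))
  · filter_upwards [eventually_ge_atTop t0] with t ht
    simp [max_eq_left ht]

lemma aux_core {t0 a b K : ℝ} (ht0 : 0 < t0) (ha : 0 < a) (hb : 0 < b) (hK : 0 ≤ K)
    {μ W v E E' G' : ℝ → ℝ}
    (hμc : ContinuousOn μ (Ici t0)) (hμ0 : ∀ t ∈ Ici t0, 0 < μ t)
    (hA1 : IntegrableOn (fun t => t * μ t) (Ioi t0))
    (hWc : ContinuousOn W (Ici t0)) (hW0 : ∀ t ∈ Ici t0, 0 ≤ W t)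
    (hvc : ContinuousOn v (Ici t0)) (hv0 : ∀ t ∈ Ici t0, 0 ≤ v t)
    (hE0 : ∀ t ∈ Ici t0, 0 ≤ E t) (hE : ∀ t ∈ Ici t0, HasDerivAt E (E' t) t)
    (hE' : ∀ t ∈ Ici t0, E' t ≤ -a * (t * W t) + K * (t * μ t))
    (hG : ∀ t ∈ Ici t0, HasDerivAt (fun t => t ^ 2 * W t + 1 / 2 * (t ^ 2 * v t)) (G' t) t)
    (hG' : ∀ t ∈ Ici t0, G' t ≤ 2 * (t * W t) - b * (t * v t)) :
    Tendsto (fun t => t ^ 2 * W t + 1 / 2 * (t ^ 2 * v t)) atTop (nhds 0) := by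
  have hpos : ∀ t ∈ Ici t0, 0 < t := fun t ht => lt_of_lt_of_le ht0 ht
  obtain ⟨M, hM0, hM, hMi⟩ := aux_prim (continuousOn_id.mul hμc)
  obtain ⟨I, hI0, hI, -⟩ := aux_prim (continuousOn_id.mul hWc)
  obtain ⟨J, hJ0, hJ, -⟩ := aux_prim (continuousOn_id.mul hvc)
  simp only [id, Pi.mul_apply] at hM hMi hI hJ
  set G : ℝ → ℝ := fun t => t ^ 2 * W t + 1 / 2 * (t ^ 2 * v t) with hGdef
  have hG0 : ∀ t ∈ Ici t0, 0 ≤ G t := by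
    intro t ht
    have := hW0 t ht
    have := hv0 t ht
    simp only [hGdef]
    positivity
  have hMB : ∀ t ∈ Ici t0, M t ≤ ∫ s in Ioi t0, s * μ s := by
    intro t ht
    rw [hMi t ht, intervalIntegral.integral_of_le ht]
    apply setIntegral_mono_set hA1
    · filter_upwards [ae_restrict_mem measurableSet_Ioi] with s hs
      have hs' : s ∈ Ici t0 := Ioi_subset_Ici_self hs
      exact (mul_pos (hpos s hs') (hμ0 s hs')).le
    · exact Ioc_subset_Ioi_self.eventuallyLE
  set B := ∫ s in Ioi t0, s * μ s
  have hanti1 : AntitoneOn (fun t => E t + a * I t - K * M t) (Ici t0) :=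
    aux_anti (fun t ht => (((hE t ht).add ((hI t ht).const_mul a)).sub ((hM t ht).const_mul K)))
      (fun t ht => by have := hE' t ht; linarith)
  have hIB : ∃ BI, ∀ t ∈ Ici t0, I t ≤ BI := by
    refine ⟨(E t0 + K * B) / a, fun t ht => ?_⟩
    have h1 := hanti1 self_mem_Ici ht ht
    simp only [hI0, hM0] at h1
    rw [le_div_iff₀ ha]
    have := mul_le_mul_of_nonneg_left (hMB t ht) hK
    have := hE0 t ht
    linarith
  obtain ⟨BI, hBI⟩ := hIB
  have hantiI : AntitoneOn (fun t => - I t) (Ici t0) :=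
    aux_anti (fun t ht => (hI t ht).neg)
      (fun t ht => by have := mul_nonneg (hpos t ht).le (hW0 t ht); linarith)
  have hanti2 : AntitoneOn (fun t => G t - 2 * I t + b * J t) (Ici t0) :=
    aux_anti (fun t ht => (((hG t ht).sub ((hI t ht).const_mul 2)).add ((hJ t ht).const_mul b)))
      (fun t ht => by have := hG' t ht; linarith)
  have hanti3 : AntitoneOn (fun t => G t - 2 * I t) (Ici t0) :=
    aux_anti (fun t ht => ((hG t ht).sub ((hI t ht).const_mul 2)))
      (fun t ht => by
        have := hG' t ht
        have := mul_nonneg hb.le (mul_nonneg (hpos t ht).le (hv0 t ht))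
        linarith)
  have hJB : ∃ BJ, ∀ t ∈ Ici t0, J t ≤ BJ := by
    refine ⟨(G t0 + 2 * BI) / b, fun t ht => ?_⟩
    have h1 := hanti2 self_mem_Ici ht ht
    simp only [hI0, hJ0] at h1
    rw [le_div_iff₀ hb]
    have := hBI t ht
    have := hG0 t ht
    linarith
  obtain ⟨BJ, hBJ⟩ := hJB
  obtain ⟨l1, hl1⟩ := aux_conv_s17 (B := -BI) hantiI (fun t ht => by have := hBI t ht; linarith)
  obtain ⟨l2, hl2⟩ := aux_conv_s17 (B := -2 * BI) hanti3
    (fun t ht => by have := hBI t ht; have := hG0 t ht; linarith)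
  have hl : Tendsto G atTop (nhds (l2 - 2 * l1)) := by
    refine (hl2.sub (hl1.const_mul 2)).congr (fun t => ?_)
    ring
  set l := l2 - 2 * l1
  have hl0 : 0 ≤ l := ge_of_tendsto hl
    (by filter_upwards [eventually_ge_atTop t0] with t ht using hG0 t ht)
  rcases hl0.eq_or_lt with h | h
  · rw [h]; exact hl
  exfalso
  have hev : ∀ᶠ t in atTop, l / 2 < G t := hl.eventually (lt_mem_nhds (by linarith))
  obtain ⟨T, hT⟩ := eventually_atTop.1 (hev.and (eventually_ge_atTop t0))
  have hT0 : t0 ≤ T := (hT T le_rfl).2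
  have hanti4 : AntitoneOn (fun t => l / 2 * Real.log t - (I t + 1 / 2 * J t)) (Ici T) := by
    refine aux_anti (f' := fun t => l / 2 * t⁻¹ - (t * W t + 1 / 2 * (t * v t)))
      (fun t ht => ?_) (fun t ht => ?_)
    · have ht' : t0 ≤ t := hT0.trans ht
      exact ((Real.hasDerivAt_log (hpos t ht').ne').const_mul _).sub
        ((hI t ht').add ((hJ t ht').const_mul _))
    · have ht' : t0 ≤ t := hT0.trans ht
      have h1 := (hT t ht).1
      have hp := hpos t ht'
      have h2 : t * W t + 1 / 2 * (t * v t) = G t * t⁻¹ := by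
        simp only [hGdef]; field_simp
      have := mul_le_mul_of_nonneg_right h1.le (inv_pos.2 hp).le
      show l / 2 * t⁻¹ - (t * W t + 1 / 2 * (t * v t)) ≤ 0
      rw [h2]; linarith
  have hlog := (Real.tendsto_log_atTop.const_mul_atTop (half_pos h)).eventually_gt_atTop
    (l / 2 * Real.log T - (I T + 1 / 2 * J T) + (BI + 1 / 2 * BJ))
  obtain ⟨t, h1, h2⟩ := (hlog.and (eventually_ge_atTop T)).exists
  have h3 := hanti4 self_mem_Ici h2 h2
  have := hBI t (hT0.trans h2)
  have := hBJ t (hT0.trans h2)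
  simp only at h3
  linarith

lemma aux_danskin {E : Type*} [NormedAddCommGroup E] [NormedSpace ℝ E]
    {K : Set (E →L[ℝ] ℝ)} (hK : IsCompact K) {v0 : E} {k0 : E →L[ℝ] ℝ} (hk0 : k0 ∈ K)
    (huniq : ∀ k ∈ K, k ≠ k0 → k v0 < k0 v0) :
    HasFDerivAt (fun v => sSup ((fun k : E →L[ℝ] ℝ => k v) '' K)) k0 v0 := by
  have hcomp : ∀ v : E, IsCompact ((fun k : E →L[ℝ] ℝ => k v) '' K) :=
    fun v => hK.image (by fun_prop)
  have hub : ∀ v : E, ∀ k ∈ K, k v ≤ sSup ((fun k : E →L[ℝ] ℝ => k v) '' K) :=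
    fun v k hk => le_csSup (hcomp v).bddAbove (mem_image_of_mem _ hk)
  have hatt : ∀ v : E, ∃ k ∈ K, k v = sSup ((fun k : E →L[ℝ] ℝ => k v) '' K) :=
    fun v => (hcomp v).sSup_mem ⟨_, mem_image_of_mem _ hk0⟩
  have hS0 : sSup ((fun k : E →L[ℝ] ℝ => k v0) '' K) = k0 v0 := by
    obtain ⟨k, hk, e⟩ := hatt v0
    by_cases h : k = k0
    · rw [← e, h]
    · exact absurd (hub v0 k0 hk0) (by rw [← e]; exact not_le.2 (huniq k hk h))
  obtain ⟨R, hR⟩ := hK.isBounded.exists_norm_le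
  have hR0 : 0 ≤ R := (norm_nonneg _).trans (hR k0 hk0)
  apply HasFDerivAt.of_isLittleO
  rw [Asymptotics.isLittleO_iff]
  intro ε hε
  have hδ : ∃ δ > 0, ∀ k ∈ K, ε ≤ ‖k - k0‖ → k v0 ≤ k0 v0 - δ := by
    have hc : IsCompact (K ∩ {k | ε ≤ ‖k - k0‖}) :=
      hK.inter_right (isClosed_le (by fun_prop) (by fun_prop))
    rcases (K ∩ {k | ε ≤ ‖k - k0‖}).eq_empty_or_nonempty with he | hne
    · refine ⟨1, one_pos, fun k hk hk' => ?_⟩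
      have : k ∈ K ∩ {k | ε ≤ ‖k - k0‖} := ⟨hk, hk'⟩
      rw [he] at this
      exact absurd this (notMem_empty _)
    · obtain ⟨k1, hk1, hmax⟩ := hc.exists_isMaxOn hne
        (f := fun k : E →L[ℝ] ℝ => k v0) (by fun_prop)
      refine ⟨k0 v0 - k1 v0, ?_, fun k hk hk' => ?_⟩
      · have : k1 ≠ k0 := by
          rintro rfl
          have := hk1.2
          simp at this
          linarith
        have := huniq k1 hk1.1 this
        simp only [gt_iff_lt, sub_pos]; exact this
      · have : k v0 ≤ k1 v0 := hmax ⟨hk, hk'⟩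
        linarith
  obtain ⟨δ, hδ0, hδ⟩ := hδ
  have hball : ∀ᶠ v in nhds v0, ‖v - v0‖ < δ / (2 * R + 1) := by
    have : Metric.ball v0 (δ / (2 * R + 1)) ∈ nhds v0 := Metric.ball_mem_nhds _ (by positivity)
    filter_upwards [this] with v hv
    rwa [Metric.mem_ball, dist_eq_norm] at hv
  filter_upwards [hball] with v hv
  rw [lt_div_iff₀ (by positivity)] at hv
  obtain ⟨k, hk, e⟩ := hatt v
  have h1 := hub v k0 hk0
  have h2 := hub v0 k hk
  rw [← e] at h1 ⊢
  rw [hS0] at h2 ⊢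
  have e1 : k (v - v0) = k v - k v0 := map_sub _ _ _
  have e2 : k0 (v - v0) = k0 v - k0 v0 := map_sub _ _ _
  have b1 : |k (v - v0)| ≤ R * ‖v - v0‖ :=
    (k.le_opNorm _).trans (by gcongr; exact hR k hk)
  have b2 : |k0 (v - v0)| ≤ R * ‖v - v0‖ :=
    (k0.le_opNorm _).trans (by gcongr; exact hR k0 hk0)
  have hclose : ‖k - k0‖ < ε := by
    by_contra hcon
    have := hδ k hk (not_lt.1 hcon)
    have := (abs_le.1 b1).2
    have := (abs_le.1 b2).1
    have := norm_nonneg (v - v0)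
    nlinarith
  have b3 : (k - k0) (v - v0) ≤ ‖k - k0‖ * ‖v - v0‖ :=
    (le_abs_self _).trans ((k - k0).le_opNorm _)
  have b4 : ‖k - k0‖ * ‖v - v0‖ ≤ ε * ‖v - v0‖ := by gcongr
  rw [sub_apply] at b3
  rw [Real.norm_eq_abs, abs_le]
  constructor <;> nlinarith [norm_nonneg (v - v0)]

lemma aux_grad_ineq {H : Type*} [NormedAddCommGroup H] [NormedSpace ℝ H] {f : H → ℝ}
    (hf : ConvexOn ℝ univ f) {x : H} (hd : DifferentiableAt ℝ f x) (y : H) :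
    fderiv ℝ f x (y - x) ≤ f y - f x := by
  have hc : ConvexOn ℝ univ (fun s : ℝ => f (AffineMap.lineMap x y s)) := by
    exact hf.comp_affineMap (AffineMap.lineMap x y : ℝ →ᵃ[ℝ] H)
  have hl : HasDerivAt (fun s : ℝ => (AffineMap.lineMap x y s : H)) (y - x) 0 :=
    AffineMap.hasDerivAt_lineMap
  have hd' : HasFDerivAt f (fderiv ℝ f x) ((AffineMap.lineMap x y : ℝ → H) 0) := by
    simpa using hd.hasFDerivAt
  have := hc.le_slope_of_hasDerivAt (mem_univ 0) (mem_univ 1) one_pos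
    (hd'.comp_hasDerivAt (0 : ℝ) hl)
  simpa [slope_def_field] using this

/-- Danskin for the regularized max, composed with differentiable data. -/
lemma aux_phi_s17 {E : Type*} [NormedAddCommGroup E] [NormedSpace ℝ E] {m : ℕ}
    {Q : Set (EuclideanSpace ℝ (Fin m))} (hQcomp : IsCompact Q)
    {D : EuclideanSpace ℝ (Fin m) → ℝ} (hDcont : Continuous D)
    {a : Fin m → E → ℝ} {b : E → ℝ} {a' : Fin m → E →L[ℝ] ℝ} {b' : E →L[ℝ] ℝ} {p : E}
    (ha : ∀ i, HasFDerivAt (a i) (a' i) p) (hb : HasFDerivAt b b' p)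
    {l0 : EuclideanSpace ℝ (Fin m)} (hl0 : l0 ∈ Q)
    (huniq : ∀ l ∈ Q, l ≠ l0 → ∑ i, l i * a i p - b p * D l < ∑ i, l0 i * a i p - b p * D l0) :
    HasFDerivAt (fun q => sSup ((fun l : EuclideanSpace ℝ (Fin m) =>
      ∑ i, l i * a i q - b q * D l) '' Q)) (∑ i, l0 i • a' i - D l0 • b') p := by
  let k : EuclideanSpace ℝ (Fin m) → ((Fin m → ℝ) × ℝ →L[ℝ] ℝ) := fun l =>
    ∑ i, l i • ((ContinuousLinearMap.proj (R := ℝ) (φ := fun _ : Fin m => ℝ) i).comp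
      (ContinuousLinearMap.fst ℝ (Fin m → ℝ) ℝ)) - D l • ContinuousLinearMap.snd ℝ (Fin m → ℝ) ℝ
  have hkc : Continuous k := by
    simp only [k]
    fun_prop
  have hk : ∀ l w, k l w = ∑ i, l i * w.1 i - w.2 * D l := by
    intro l w
    simp [k, mul_comm]
  have h1 := aux_danskin (hQcomp.image hkc) (v0 := ((fun i => a i p), b p)) (k0 := k l0)
    (mem_image_of_mem _ hl0) (by
      rintro _ ⟨l, hl, rfl⟩ hne
      rw [hk, hk]
      exact huniq l hl (fun h => hne (by rw [h])))
  have h2 : HasFDerivAt (fun q => ((fun i => a i q), b q)) ((ContinuousLinearMap.pi a').prod b') p :=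
    (hasFDerivAt_pi.2 ha).prodMk hb
  have h3 := HasFDerivAt.comp p h1 h2
  have e1 : (fun q => sSup ((fun l : EuclideanSpace ℝ (Fin m) =>
      ∑ i, l i * a i q - b q * D l) '' Q)) =
      (fun v => sSup ((fun k : (Fin m → ℝ) × ℝ →L[ℝ] ℝ => k v) '' (k '' Q))) ∘
        fun q => ((fun i => a i q), b q) := by
    funext q
    simp only [Function.comp, image_image, hk]
  have e2 : (∑ i, l0 i • a' i - D l0 • b') = (k l0).comp ((ContinuousLinearMap.pi a').prod b') := by
    ext w
    simp [hk, mul_comm]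
  rw [e1, e2]
  exact h3

theorem statement17 {H : Type*} [NormedAddCommGroup H] [InnerProductSpace ℝ H]
    [CompleteSpace H]
    (m : ℕ) (hm : 1 ≤ m)
    (g : Fin m → H → ℝ) (hg : ∀ i, ConvexOn ℝ Set.univ (g i))
    (hgdiff : ∀ i, Differentiable ℝ (g i))
    -- each `∇ g i` is Lipschitz continuous on every bounded set
    (hgradLip : ∀ i, ∀ s : Set H, Bornology.IsBounded s →
      ∃ Li : ℝ, ∀ x ∈ s, ∀ y ∈ s,
        ‖gradient (g i) x - gradient (g i) y‖ ≤ Li * ‖x - y‖)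
    (Q : Set (EuclideanSpace ℝ (Fin m))) (hQne : Q.Nonempty) (hQcomp : IsCompact Q)
    (hQconv : Convex ℝ Q) (hQpos : ∀ l ∈ Q, ∀ i, 0 ≤ l i)
    (D : EuclideanSpace ℝ (Fin m) → ℝ) (hDcont : Continuous D)
    (hDnonneg : ∀ l ∈ Q, 0 ≤ D l)
    (σ : ℝ) (hσ : 0 < σ) (hDsc : StrongConvexOn Q σ D)
    (hDinf : IsGLB (D '' Q) 0)
    (C : ℝ) (hC : IsLUB (D '' Q) C)
    -- `D` is differentiable on a neighborhood `U` of `Q`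
    (U : Set (EuclideanSpace ℝ (Fin m))) (hUopen : IsOpen U) (hQU : Q ⊆ U)
    (hDdiff : ∀ l ∈ U, DifferentiableAt ℝ D l)
    -- `xstar` is a minimizer of `φ` (so `inf φ = φ xstar`)
    (xstar : H) (hstar : ∀ y : H, phi m g Q xstar ≤ phi m g Q y)
    -- time data
    (t0 α : ℝ) (ht0 : 0 < t0) (hα : 3 < α)
    -- `μ` is continuously differentiable, positive and nonincreasing on `[t0, ∞)`
    (μ μ' : ℝ → ℝ) (hμpos : ∀ t ∈ Set.Ici t0, 0 < μ t)
    (hμderiv : ∀ t ∈ Set.Ici t0, HasDerivAt μ (μ' t) t)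
    (hμ'cont : ContinuousOn μ' (Set.Ici t0))
    (hμanti : AntitoneOn μ (Set.Ici t0))
    -- `x` is a twice continuously differentiable solution of the inertial system
    (x x' x'' : ℝ → H)
    (hx' : ∀ t ∈ Set.Ici t0, HasDerivAt x (x' t) t)
    (hx'' : ∀ t ∈ Set.Ici t0, HasDerivAt x' (x'' t) t)
    (hx''cont : ContinuousOn x'' (Set.Ici t0))
    (hODE : ∀ t ∈ Set.Ici t0,
      x'' t + (α / t) • x' t + gradient (phiMu m g Q D (μ t)) (x t) = 0)
    -- Assumption A
    (hA1 : MeasureTheory.IntegrableOn (fun t => t * μ t) (Set.Ioi t0))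
    (hA2 : MeasureTheory.IntegrableOn (fun t => t ^ 2 * |μ' t|) (Set.Ioi t0))
 :
    Filter.Tendsto (fun t => t * ‖x' t‖) Filter.atTop (nhds 0) := by
  classical
  have hpos : ∀ t ∈ Ici t0, 0 < t := fun t ht => lt_of_lt_of_le ht0 ht
  have hDC : ∀ l ∈ Q, D l ≤ C := fun l hl => hC.1 (mem_image_of_mem _ hl)
  have hC0 : 0 ≤ C := by
    obtain ⟨l, hl⟩ := hQne
    exact (hDnonneg l hl).trans (hDC l hl)
  have hcs : ∀ (ν : ℝ) (y : H), Continuous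
      (fun l : EuclideanSpace ℝ (Fin m) => ∑ i, l i * g i y - ν * D l) := by
    intro ν y; fun_prop
  have hcs0 : ∀ (y : H), Continuous
      (fun l : EuclideanSpace ℝ (Fin m) => ∑ i, l i * g i y) := by
    intro y; fun_prop
  have hle : ∀ (ν : ℝ) (y : H), ∀ l ∈ Q, ∑ i, l i * g i y - ν * D l ≤ phiMu m g Q D ν y :=
    fun ν y l hl => le_csSup (hQcomp.image (hcs ν y)).bddAbove (mem_image_of_mem _ hl)
  have hle0 : ∀ (y : H), ∀ l ∈ Q, ∑ i, l i * g i y ≤ phi m g Q y :=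
    fun y l hl => le_csSup (hQcomp.image (hcs0 y)).bddAbove (mem_image_of_mem _ hl)
  have hlow : ∀ ν : ℝ, 0 < ν → ∀ y, phiMu m g Q D ν y ≤ phi m g Q y := by
    intro ν hν y
    apply csSup_le (hQne.image _)
    rintro _ ⟨l, hl, rfl⟩
    have := hle0 y l hl
    have := mul_nonneg hν.le (hDnonneg l hl)
    simp only
    linarith
  have hup : ∀ ν : ℝ, 0 < ν → ∀ y, phi m g Q y ≤ phiMu m g Q D ν y + C * ν := by
    intro ν hν y
    apply csSup_le (hQne.image _)
    rintro _ ⟨l, hl, rfl⟩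
    have := hle ν y l hl
    have := mul_le_mul_of_nonneg_left (hDC l hl) hν.le
    simp only
    linarith
  have hmax : ∀ ν : ℝ, 0 < ν → ∀ y, ∃ l0 ∈ Q, phiMu m g Q D ν y = ∑ i, l0 i * g i y - ν * D l0 ∧
      ∀ l ∈ Q, l ≠ l0 → ∑ i, l i * g i y - ν * D l < ∑ i, l0 i * g i y - ν * D l0 := by
    intro ν hν y
    obtain ⟨l0, hl0, e⟩ := (hQcomp.image (hcs ν y)).sSup_mem (hQne.image _)
    refine ⟨l0, hl0, e.symm, fun l hl hne => ?_⟩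
    have hS : phiMu m g Q D ν y = ∑ i, l0 i * g i y - ν * D l0 := e.symm
    by_contra hcon
    have hcon := not_lt.1 hcon
    have hsc := (hDsc.strictConvexOn hσ).2 hl hl0 hne (by norm_num : (0 : ℝ) < 1 / 2)
      (by norm_num : (0 : ℝ) < 1 / 2) (by norm_num)
    have hmem := hQconv hl hl0 (by norm_num : (0 : ℝ) ≤ 1 / 2)
      (by norm_num : (0 : ℝ) ≤ 1 / 2) (by norm_num)
    have h1 := hle ν y _ hmem
    have h2 : ∑ i, ((1 / 2 : ℝ) • l + (1 / 2 : ℝ) • l0) i * g i y =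
        1 / 2 * ∑ i, l i * g i y + 1 / 2 * ∑ i, l0 i * g i y := by
      rw [Finset.mul_sum, Finset.mul_sum, ← Finset.sum_add_distrib]
      refine Finset.sum_congr rfl fun i _ => ?_
      simp
      ring
    rw [h2, hS] at h1
    have := mul_lt_mul_of_pos_left hsc hν
    simp only [smul_eq_mul] at this
    linarith
  have hkey : ∀ t ∈ Ici t0, ∃ l ∈ Q,
      HasDerivAt (fun s => phiMu m g Q D (μ s) (x s))
        (inner ℝ (gradient (phiMu m g Q D (μ t)) (x t)) (x' t) - D l * μ' t) t ∧
      inner ℝ (gradient (phiMu m g Q D (μ t)) (x t)) (xstar - x t) ≤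
        phiMu m g Q D (μ t) xstar - phiMu m g Q D (μ t) (x t) := by
    intro t ht
    obtain ⟨l, hl, e, hu⟩ := hmax (μ t) (hμpos t ht) (x t)
    have hd : ∀ i, HasFDerivAt (g i) (fderiv ℝ (g i) (x t)) (x t) :=
      fun i => (hgdiff i (x t)).hasFDerivAt
    have h1 : HasFDerivAt (phiMu m g Q D (μ t))
        (∑ i, l i • fderiv ℝ (g i) (x t) - D l • (0 : H →L[ℝ] ℝ)) (x t) :=
      aux_phi_s17 hQcomp hDcont hd (hasFDerivAt_const (μ t) (x t)) hl hu
    have hgr : ∀ w, inner ℝ (gradient (phiMu m g Q D (μ t)) (x t)) w =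
        ∑ i, l i * fderiv ℝ (g i) (x t) w := by
      intro w
      have h3 : (InnerProductSpace.toDual ℝ H) (gradient (phiMu m g Q D (μ t)) (x t)) w =
        fderiv ℝ (phiMu m g Q D (μ t)) (x t) w := by rw [toDual_gradient]
      rw [InnerProductSpace.toDual_apply_apply, h1.fderiv] at h3
      rw [h3]
      simp
    refine ⟨l, hl, ?_, ?_⟩
    · have h2 := aux_phi_s17 (a := fun i s => g i (x s)) (b := μ) (p := t) hQcomp hDcont
        (fun i => ((hd i).comp_hasDerivAt t (hx' t ht)).hasFDerivAt) (hμderiv t ht).hasFDerivAt hl hu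
      have h4 := h2.hasDerivAt
      rw [hgr]
      refine h4.congr_deriv ?_
      simp
    · rw [hgr, e]
      have h5 := hle (μ t) xstar l hl
      have h6 : ∑ i, l i * fderiv ℝ (g i) (x t) (xstar - x t) ≤
          ∑ i, (l i * g i xstar - l i * g i (x t)) := by
        refine Finset.sum_le_sum fun i _ => ?_
        rw [← mul_sub]
        exact mul_le_mul_of_nonneg_left (aux_grad_ineq (hg i) (hgdiff i _) _) (hQpos l hl i)
      rw [Finset.sum_sub_distrib] at h6
      linarith
  choose! lam hlam hF hgi using hkey
  set Gr : ℝ → H := fun t => gradient (phiMu m g Q D (μ t)) (x t) with hGr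
  set W : ℝ → ℝ := fun t => phiMu m g Q D (μ t) (x t) + C * μ t - phi m g Q xstar with hWdef
  have hμ'0 : ∀ t ∈ Ici t0, μ' t ≤ 0 := by
    intro t ht
    have h1 := hμanti.derivWithin_nonpos (x := t)
    rwa [(hμderiv t ht).hasDerivWithinAt.derivWithin (uniqueDiffOn_Ici t0 t ht)] at h1
  have hW : ∀ t ∈ Ici t0, HasDerivAt W (inner ℝ (Gr t) (x' t) + (C - D (lam t)) * μ' t) t := by
    intro t ht
    refine (((hF t ht).add ((hμderiv t ht).const_mul C)).sub_const _).congr_deriv ?_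
    simp only [hGr]
    ring
  have hW0 : ∀ t ∈ Ici t0, 0 ≤ W t := by
    intro t ht
    have := hup (μ t) (hμpos t ht) (x t)
    have := hstar (x t)
    simp only [hWdef]
    linarith
  have hWc : ∀ t ∈ Ici t0, (C - D (lam t)) * μ' t ≤ 0 := fun t ht =>
    mul_nonpos_of_nonneg_of_nonpos (by linarith [hDC _ (hlam t ht)]) (hμ'0 t ht)
  have hconv : ∀ t ∈ Ici t0, W t - C * μ t ≤ inner ℝ (Gr t) (x t - xstar) := by
    intro t ht
    have h1 := hgi t ht
    have h2 := hlow (μ t) (hμpos t ht) xstar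
    rw [← neg_sub (x t) xstar, inner_neg_right] at h1
    simp only [hWdef, hGr]
    linarith
  have hode : ∀ t ∈ Ici t0, x'' t = -((α / t) • x' t) - Gr t := by
    intro t ht
    have h1 : x'' t + (α / t) • x' t + Gr t = 0 := hODE t ht
    have h2 : x'' t = (x'' t + (α / t) • x' t + Gr t) - (α / t) • x' t - Gr t := by abel
    rw [h2, h1]; abel
  have hy : ∀ t ∈ Ici t0, HasDerivAt (fun s => (α - 1) • (x s - xstar) + s • x' s)
      (-(t • Gr t)) t := by
    intro t ht
    refine ((((hx' t ht).sub_const xstar).const_smul (α - 1)).add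
      ((hasDerivAt_id t).smul (hx'' t ht))).congr_deriv ?_
    rw [hode t ht]
    have : t ≠ 0 := (hpos t ht).ne'
    simp only [id, smul_sub, smul_neg, smul_smul, mul_div_cancel₀ _ this]
    module
  have hmain := aux_core (t0 := t0) (a := α - 3) (b := α - 1) (K := (α - 1) * C) (μ := μ) (W := W)
    (v := fun t => ‖x' t‖ ^ 2)
    (E := fun t => t ^ 2 * W t + 1 / 2 * ‖(α - 1) • (x t - xstar) + t • x' t‖ ^ 2)
    (E' := fun t => ((2 : ℕ) * t ^ (2 - 1) * W t + t ^ 2 * (inner ℝ (Gr t) (x' t)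
      + (C - D (lam t)) * μ' t)) + 1 / 2 * (2 * inner ℝ ((α - 1) • (x t - xstar) + t • x' t)
      (-(t • Gr t))))
    (G' := fun t => ((2 : ℕ) * t ^ (2 - 1) * W t + t ^ 2 * (inner ℝ (Gr t) (x' t)
      + (C - D (lam t)) * μ' t)) + 1 / 2 * ((2 : ℕ) * t ^ (2 - 1) * ‖x' t‖ ^ 2
      + t ^ 2 * (2 * inner ℝ (x' t) (x'' t))))
    ht0 (by linarith) (by linarith) (mul_nonneg (by linarith) hC0)
    (fun t ht => (hμderiv t ht).continuousAt.continuousWithinAt) hμpos hA1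
    (fun t ht => (hW t ht).continuousAt.continuousWithinAt) hW0
    (fun t ht => (hx'' t ht).norm_sq.continuousAt.continuousWithinAt) (fun t ht => by positivity)
    (fun t ht => by have := hW0 t ht; positivity)
    (fun t ht => ((hasDerivAt_pow 2 t).mul (hW t ht)).add ((hy t ht).norm_sq.const_mul _))
    (by
      intro t ht
      have hp := hpos t ht
      have h1 := mul_le_mul_of_nonneg_left (hconv t ht)
        (mul_nonneg hp.le (by linarith : (0 : ℝ) ≤ α - 1))
      have h2 := mul_le_mul_of_nonneg_left (hWc t ht) (sq_nonneg t)
      have h3 : inner ℝ ((α - 1) • (x t - xstar) + t • x' t) (-(t • Gr t)) =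
          -(t * (α - 1)) * inner ℝ (Gr t) (x t - xstar) - t ^ 2 * inner ℝ (Gr t) (x' t) := by
        rw [inner_neg_right, inner_smul_right, inner_add_left, real_inner_smul_left,
          real_inner_smul_left, real_inner_comm (Gr t), real_inner_comm (Gr t)]
        ring
      simp only [h3]
      norm_num
      linarith)
    (fun t ht => ((hasDerivAt_pow 2 t).mul (hW t ht)).add
      (((hasDerivAt_pow 2 t).mul (hx'' t ht).norm_sq).const_mul _))
    (by
      intro t ht
      have hp := hpos t ht
      have h2 := mul_le_mul_of_nonneg_left (hWc t ht) (sq_nonneg t)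
      have h3 : t ^ 2 * inner ℝ (x' t) (x'' t) =
          -(α * (t * ‖x' t‖ ^ 2)) - t ^ 2 * inner ℝ (Gr t) (x' t) := by
        rw [hode t ht, inner_sub_right, inner_neg_right, inner_smul_right,
          real_inner_self_eq_norm_sq, real_inner_comm (Gr t)]
        field_simp
      norm_num
      linarith)
  have hsq : Tendsto (fun t => (t * ‖x' t‖) ^ 2) atTop (nhds 0) := by
    have h2 := hmain.const_mul 2
    rw [mul_zero] at h2
    refine tendsto_of_tendsto_of_tendsto_of_le_of_le' tendsto_const_nhds h2
      (Eventually.of_forall fun t => sq_nonneg _) ?_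
    filter_upwards [eventually_ge_atTop t0] with t ht
    have := mul_nonneg (sq_nonneg t) (hW0 t ht)
    rw [mul_pow]
    linarith
  have hs := (Real.continuous_sqrt.tendsto 0).comp hsq
  rw [Real.sqrt_zero] at hs
  refine hs.congr' ?_
  filter_upwards [eventually_ge_atTop t0] with t ht
  exact Real.sqrt_sq (mul_nonneg (hpos t ht).le (norm_nonneg _))
end

section
/- Let t0 > 0 and let μ : [t0,∞) → (0,∞) be continuously differentiable and nonincreasing with lim_{s→∞} μ(s) = 0 and ∫_{t0}^∞ s² |μ̇(s)| ds < ∞. Then lim_{s→∞} s² μ(s) = 0. -/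
open Set Filter MeasureTheory

theorem statement18 (t0 : ℝ) (ht0 : 0 < t0)
    (μ μ' : ℝ → ℝ) (hμpos : ∀ t ∈ Set.Ici t0, 0 < μ t)
    (hμderiv : ∀ t ∈ Set.Ici t0, HasDerivAt μ (μ' t) t)
    (hμ'cont : ContinuousOn μ' (Set.Ici t0))
    (hμanti : AntitoneOn μ (Set.Ici t0))
    (hμlim : Filter.Tendsto μ Filter.atTop (nhds 0))
    (hint : MeasureTheory.IntegrableOn (fun s => s ^ 2 * |μ' s|) (Set.Ioi t0)) :
    Filter.Tendsto (fun s => s ^ 2 * μ s) Filter.atTop (nhds 0) := by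
  have hneg : ∀ x ∈ Ici t0, μ' x ≤ 0 := by
    intro x hx
    rw [← (hμderiv x hx).hasDerivWithinAt.derivWithin (uniqueDiffOn_Ici t0 x hx)]
    exact hμanti.derivWithin_nonpos
  have hz : Tendsto (fun t : ℝ => ∫ s in Ioi t, s ^ 2 * |μ' s|) atTop (nhds 0) :=
    tendsto_integral_Ioi_zero tendsto_id
  refine tendsto_of_tendsto_of_tendsto_of_le_of_le' tendsto_const_nhds hz ?_ ?_
  · filter_upwards [Ici_mem_atTop t0] with t ht
    exact mul_nonneg (sq_nonneg t) (hμpos t ht).le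
  · filter_upwards [Ici_mem_atTop t0] with t ht
    have hd : ∀ x ∈ Ici t, HasDerivAt μ (μ' x) x := fun x hx => hμderiv x (mem_Ici.2 (le_trans (mem_Ici.1 ht) (mem_Ici.1 hx)))
    have hn : ∀ x ∈ Ioi t, μ' x ≤ 0 := fun x hx => hneg x (mem_Ici.2 (le_trans (mem_Ici.1 ht) (le_of_lt (mem_Ioi.1 hx))))
    have hi : IntegrableOn μ' (Ioi t) := integrableOn_Ioi_deriv_of_nonpos' hd hn hμlim
    have he := integral_Ioi_of_hasDerivAt_of_nonpos' hd hn hμlim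
    have h1 : t ^ 2 * μ t = ∫ s in Ioi t, t ^ 2 * (- μ' s) := by
      rw [integral_const_mul, integral_neg, he]; ring
    rw [h1]
    refine setIntegral_mono_on (hi.neg.const_mul _) (hint.mono_set (Ioi_subset_Ioi (mem_Ici.1 ht)))
      measurableSet_Ioi ?_
    intro x hx
    rw [abs_of_nonpos (hn x hx)]
    have h0 : 0 ≤ t := ht0.le.trans (mem_Ici.1 ht)
    exact mul_le_mul_of_nonneg_right (pow_le_pow_left₀ h0 (le_of_lt (mem_Ioi.1 hx)) 2)
      (neg_nonneg.2 (hn x hx))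
end
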